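/- arXiv:2504.05073 — 5 statements merged into one kernel-verified Lean document; each statement's English description precedes it below -/
import Mathlib

section
/- Let (R, m) → (S, n) be a local homomorphism of Noetherian local rings which is essentially smooth (i.e. a localization of a smooth algebra). Then ecodim(S) = ecodim(R), where ecodim denotes embedding dimension minus Krull dimension. More precisely: edim(S) = edim(R) + edim(S ⊗_R R/m) and dim(S) = dim(R) + dim(S ⊗_R R/m), and the closed fiber S ⊗_R R/m is regular, whence edim(S) − dim(S) = edim(R) − dim(R). -/
open IsLocalRing

/-- The embedding dimension of a local ring: the dimension of `m/m²` over the residue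
field. -/
noncomputable def embDim (A : Type*) [CommRing A] [IsLocalRing A] : ℕ :=
  Module.finrank (ResidueField A) (CotangentSpace A)

lemma embDim_eq_spanFinrank (A : Type*) [CommRing A] [IsLocalRing A] [IsNoetherianRing A] :
    embDim A = (maximalIdeal A).spanFinrank :=
  (spanFinrank_maximalIdeal_eq_finrank_cotangentSpace A).symm

/-- Minimal generators of an ideal. -/
lemma exists_min_generators {A : Type*} [CommRing A] [IsLocalRing A] [IsNoetherianRing A]
    (I : Ideal A) : ∃ z : Fin I.spanFinrank → A, Ideal.span (Set.range z) = I ∧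
      ∀ c : Fin I.spanFinrank → A, ∑ i, c i * z i ∈ maximalIdeal A * I →
        ∀ i, c i ∈ maximalIdeal A := by
  classical
  obtain ⟨s, hcard, hspan⟩ :=
    Submodule.FG.exists_span_finset_card_eq_spanFinrank (I.fg_of_isNoetherianRing)
  let e : Fin I.spanFinrank ≃ s := (Fintype.equivFinOfCardEq (by simpa using hcard)).symm
  let z : Fin I.spanFinrank → A := fun i => (e i : A)
  have hr : Set.range z = (s : Set A) := by
    have : z = Subtype.val ∘ e := rfl
    rw [this, e.surjective.range_comp]
    simp
  have hz : Ideal.span (Set.range z) = I := by rw [hr]; exact hspan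
  refine ⟨z, hz, fun c hc j => ?_⟩
  by_contra hj
  have hmem : ∀ x ∈ maximalIdeal A * I, ∃ d : Fin I.spanFinrank → A,
      (∀ i, d i ∈ maximalIdeal A) ∧ ∑ i, d i * z i = x := by
    intro x hx
    have hx' : x ∈ maximalIdeal A • Submodule.span A (Set.range z) := by
      have h0 : Submodule.span A (Set.range z) = I := hz
      rw [h0]
      exact hx
    obtain ⟨a, ha, hax⟩ := (Submodule.mem_ideal_smul_span_iff_exists_sum _ z x).1 hx'
    refine ⟨a, ha, ?_⟩
    rw [← hax, Finsupp.sum_fintype _ _ (by simp)]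
    rfl
  obtain ⟨d, hd, hdx⟩ := hmem _ hc
  have hu : IsUnit (c j - d j) := by
    by_contra hu
    have h1 : c j - d j ∈ maximalIdeal A := (mem_maximalIdeal _).2 hu
    exact hj (by simpa using add_mem h1 (hd j))
  let t : Set A := z '' {i | i ≠ j}
  have hzj : z j ∈ Ideal.span t := by
    have h0 : ∑ i, (c i - d i) * z i = 0 := by
      simp only [sub_mul, Finset.sum_sub_distrib, hdx, sub_self]
    rw [← Finset.add_sum_erase _ _ (Finset.mem_univ j)] at h0
    have h2 : (c j - d j) * z j ∈ Ideal.span t := by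
      rw [eq_neg_of_add_eq_zero_left h0]
      refine neg_mem (sum_mem fun i hi => Ideal.mul_mem_left _ _ (Ideal.subset_span ⟨i, ?_, rfl⟩))
      simpa using hi
    exact (Ideal.unit_mul_mem_iff_mem _ hu).1 h2
  have hI : Ideal.span t = I := by
    apply le_antisymm
    · rw [← hz]; exact Ideal.span_mono (Set.image_subset_range _ _)
    · rw [← hz, Ideal.span_le]
      rintro _ ⟨i, rfl⟩
      by_cases hij : i = j
      · subst hij; exact hzj
      · exact Ideal.subset_span ⟨i, hij, rfl⟩
  have h3 : I.spanFinrank ≤ t.ncard := by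
    conv_lhs => rw [← hI]
    exact Submodule.spanFinrank_span_le_ncard_of_finite (Set.toFinite _)
  have h4 : t.ncard ≤ ({i | i ≠ j} : Set (Fin I.spanFinrank)).ncard :=
    Set.ncard_image_le (Set.toFinite _)
  have h5 : ({i | i ≠ j} : Set (Fin I.spanFinrank)).ncard < I.spanFinrank := by
    have := Set.ncard_lt_card (s := ({i | i ≠ j} : Set (Fin I.spanFinrank)))
      (by intro h; have : j ∈ ({i | i ≠ j} : Set (Fin I.spanFinrank)) := h ▸ Set.mem_univ j
          simp at this)
    simpa using this
  omega

lemma card_le_embDim {A : Type*} [CommRing A] [IsLocalRing A] [IsNoetherianRing A]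
    {ι : Type*} [Fintype ι] (x : ι → A) (hx : ∀ i, x i ∈ maximalIdeal A)
    (h : ∀ c : ι → A, ∑ i, c i * x i ∈ maximalIdeal A ^ 2 → ∀ i, c i ∈ maximalIdeal A) :
    Fintype.card ι ≤ embDim A := by
  let v : ι → CotangentSpace A := fun i => (maximalIdeal A).toCotangent ⟨x i, hx i⟩
  have hv : LinearIndependent (ResidueField A) v := by
    rw [Fintype.linearIndependent_iff]
    intro g hg i
    choose c hc using fun i => residue_surjective (g i)
    have hs : (maximalIdeal A).toCotangent (∑ i, c i • ⟨x i, hx i⟩) = 0 := by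
      rw [← hg, map_sum]
      refine Finset.sum_congr rfl fun i _ => ?_
      rw [← hc i, map_smul]
      rfl
    rw [Ideal.toCotangent_eq_zero] at hs
    rw [← hc i, residue_eq_zero_iff]
    refine h c ?_ i
    simpa using hs
  exact hv.fintype_card_le_finrank

lemma flat_indep {R T : Type*} [CommRing R] [CommRing T] [Algebra R T] [Module.Flat R T]
    [IsNoetherianRing R] (m : Ideal R) {ι : Type*} [Fintype ι] (x : ι → R)
    (h : ∀ c : ι → R, ∑ i, c i * x i ∈ m ^ 2 → ∀ i, c i ∈ m) (t : ι → T)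
    (ht : ∑ i, t i * algebraMap R T (x i) ∈ (m ^ 2).map (algebraMap R T)) (i : ι) :
    t i ∈ m.map (algebraMap R T) := by
  obtain ⟨n, z, hz⟩ := Submodule.fg_iff_exists_fin_generating_family.1
    ((m ^ 2).fg_of_isNoetherianRing)
  have hz' : Ideal.span (Set.range z) = m ^ 2 := hz
  rw [← hz', Ideal.map_span, ← Set.range_comp] at ht
  obtain ⟨u, hu⟩ := (Submodule.mem_span_range_iff_exists_fun _).1 ht
  have hrel : ∑ k : ι ⊕ Fin n, (Sum.elim x z k) • (Sum.elim t (fun l => - u l) k) = 0 := by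
    simp only [Fintype.sum_sum_type, Sum.elim_inl, Sum.elim_inr, Algebra.smul_def]
    simp only [smul_eq_mul, Function.comp] at hu
    simp only [mul_comm (algebraMap R T _), neg_mul, Finset.sum_neg_distrib]
    rw [hu, add_neg_cancel]
  obtain ⟨k, a, y, h1, h2⟩ := Module.Flat.isTrivialRelation_of_sum_smul_eq_zero (R := R) (M := T)
    (f := Sum.elim x z) (x := Sum.elim t (fun l => - u l)) hrel
  have h3 : t i = ∑ j, a (Sum.inl i) j • y j := h1 (Sum.inl i)
  rw [h3]
  refine sum_mem fun j _ => ?_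
  rw [Algebra.smul_def]
  refine Ideal.mul_mem_right _ _ (Ideal.mem_map_of_mem _ ?_)
  refine h (fun i => a (Sum.inl i) j) ?_ i
  have h4 := h2 j
  simp only [Fintype.sum_sum_type, Sum.elim_inl, Sum.elim_inr] at h4
  simp only [mul_comm (a _ _)]
  rw [eq_neg_of_add_eq_zero_left h4]
  refine neg_mem (sum_mem fun l _ => Ideal.mul_mem_right _ _ ?_)
  rw [← hz']
  exact Ideal.subset_span ⟨l, rfl⟩

lemma exists_surj_localization (R S : Type*) [CommRing R] [CommRing S] [IsLocalRing S]
    [Algebra R S] [Algebra.EssFiniteType R S] :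
    ∃ (n : ℕ) (q : Ideal (MvPolynomial (Fin n) R)) (_ : q.IsPrime)
      (f : Localization.AtPrime q →ₐ[R] S), Function.Surjective f := by
  obtain ⟨n, g, hg⟩ := (Algebra.FiniteType.iff_quotient_mvPolynomial''
    (R := R) (S := Algebra.EssFiniteType.subalgebra R S)).1 inferInstance
  let ψ : MvPolynomial (Fin n) R →ₐ[R] S := (Subalgebra.val _).comp g
  let q : Ideal (MvPolynomial (Fin n) R) := (maximalIdeal S).comap ψ
  have hq : q.IsPrime := Ideal.comap_isPrime _ _
  have hunit : ∀ y : q.primeCompl, IsUnit (ψ y) := by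
    rintro ⟨y, hy⟩
    by_contra h
    exact hy ((mem_maximalIdeal _).2 h)
  let f : Localization.AtPrime q →ₐ[R] S := IsLocalization.liftAlgHom (M := q.primeCompl) hunit
  refine ⟨n, q, hq, f, fun s => ?_⟩
  obtain ⟨⟨a, b⟩, hab⟩ := IsLocalization.surj (Algebra.EssFiniteType.submonoid R S) s
  obtain ⟨a', rfl⟩ := hg a
  obtain ⟨b', hb'⟩ := hg b
  have hbu : IsUnit (ψ b') := by
    change IsUnit ((g b' : S))
    rw [hb']
    exact b.2
  have hbq : b' ∈ q.primeCompl := fun h => (mem_maximalIdeal _).1 h hbu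
  refine ⟨IsLocalization.mk' _ a' ⟨b', hbq⟩, ?_⟩
  have h1 : f (IsLocalization.mk' _ a' ⟨b', hbq⟩) * ψ b' = ψ a' := by
    have h2 : ∀ p, f (algebraMap _ _ p) = ψ p := fun p => by simp [f]
    rw [← h2, ← map_mul, IsLocalization.mk'_spec, h2]
  refine hbu.mul_right_cancel (h1.trans ?_)
  simp only at hab
  rw [← hb'] at hab
  exact hab.symm

lemma flat_of_formallySmooth_essFiniteType (R S : Type*) [CommRing R] [CommRing S] [IsLocalRing S]
    [IsNoetherianRing R]
    [Algebra R S] [Algebra.EssFiniteType R S] [Algebra.FormallySmooth R S] : Module.Flat R S := by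
  obtain ⟨n, q, hq, f, hf⟩ := exists_surj_localization R S
  have : Module.Flat R (Localization.AtPrime q) := .trans _ (MvPolynomial (Fin n) R) _
  have : IsNoetherianRing (Localization.AtPrime q) :=
    IsLocalization.isNoetherianRing q.primeCompl _ inferInstance
  exact Algebra.FormallySmooth.flat_of_algHom_of_isNoetherianRing f hf


section Gonflement

universe v

/-- The intermediate field `E` of `K` over the residue field of `R` lifts to a flat `R`-algebra. -/
def HasFlatLift (R K : Type v) [CommRing R] [IsLocalRing R] [Field K] [Algebra R K]
    (E : Set K) : Prop :=
  ∃ (T : Type v) (_ : CommRing T) (_ : Algebra R T) (_ : Module.Flat R T) (φ : T →ₐ[R] K),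
    Set.range φ = E ∧ ∀ t, φ t = 0 → t ∈ (maximalIdeal R).map (algebraMap R T)

variable {R K : Type v} [CommRing R] [IsLocalRing R] [Field K] [Algebra R K]

lemma poly_mem_map {T F : Type*} [CommRing T] [Algebra R T] [Field F] (g : T →+* F) (I : Ideal R)
    (hg : ∀ t, g t = 0 → t ∈ I.map (algebraMap R T)) (p : Polynomial T) (hp : p.map g = 0) :
    p ∈ I.map (algebraMap R (Polynomial T)) := by
  have h1 : p ∈ (I.map (algebraMap R T)).map (Polynomial.C : T →+* Polynomial T) := by
    rw [Ideal.mem_map_C_iff]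
    intro n
    apply hg
    rw [← Polynomial.coeff_map, hp, Polynomial.coeff_zero]
  rwa [Ideal.map_map] at h1

lemma hasFlatLift_step [Algebra (ResidueField R) K] [IsScalarTower R (ResidueField R) K]
    (E : IntermediateField (ResidueField R) K) (x : K) (h : HasFlatLift R K (E : Set K)) :
    HasFlatLift R K ((IntermediateField.adjoin E {x} : IntermediateField E K) : Set K) := by
  obtain ⟨T, _, _, _, φ, hrange, hker⟩ := h
  have hmem : ∀ t, φ t ∈ E := fun t => by
    have : φ t ∈ (E : Set K) := hrange ▸ Set.mem_range_self t
    exact this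
  let g : T →+* E := (φ : T →+* K).codRestrict E hmem
  have hgφ : ∀ t, ((g t : E) : K) = φ t := fun t => rfl
  have hgs : Function.Surjective g := by
    rintro ⟨y, hy⟩
    have : y ∈ Set.range φ := by rw [hrange]; exact hy
    obtain ⟨t, rfl⟩ := this
    exact ⟨t, rfl⟩
  have hgk : ∀ t, g t = 0 → t ∈ (maximalIdeal R).map (algebraMap R T) := fun t ht =>
    hker t (by rw [← hgφ, ht]; rfl)
  have hgms : Function.Surjective (Polynomial.map g) := Polynomial.map_surjective g hgs
  let Ψ : Polynomial T →ₐ[R] K := 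
    { Polynomial.eval₂RingHom (φ : T →+* K) x with
      commutes' := fun r => by
        change Polynomial.eval₂ (φ : T →+* K) x (Polynomial.C (algebraMap R T r)) = _
        rw [Polynomial.eval₂_C]
        exact φ.commutes r }
  have hΨ : ∀ p : Polynomial T, Ψ p = Polynomial.aeval x (p.map g) := by
    intro p
    change Polynomial.eval₂ (φ : T →+* K) x p = _
    rw [Polynomial.aeval_def, Polynomial.eval₂_map]
    rfl
  by_cases hx : IsIntegral E x
  · obtain ⟨f, hf1, -, hf3⟩ := Polynomial.lifts_and_natDegree_eq_and_monic
      (f := g) (p := minpoly E x) (by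
        rw [Polynomial.mem_lifts]; exact hgms _) (minpoly.monic hx)
    have hΨf : Ψ f = 0 := by rw [hΨ, hf1, minpoly.aeval]
    have hfree : Module.Free T (AdjoinRoot f) := hf3.free_adjoinRoot
    have hflat : Module.Flat R (AdjoinRoot f) := .trans R T _
    let φ' : AdjoinRoot f →ₐ[R] K := Ideal.Quotient.liftₐ (Ideal.span {f}) Ψ (by
      intro a ha
      obtain ⟨b, rfl⟩ := Ideal.mem_span_singleton'.1 ha
      rw [map_mul, hΨf, mul_zero])
    have hφ' : ∀ p, φ' (AdjoinRoot.mk f p) = Ψ p := fun p => rfl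
    refine ⟨AdjoinRoot f, inferInstance, inferInstance, hflat, φ', ?_, ?_⟩
    · have hE : ((IntermediateField.adjoin E {x} : IntermediateField E K) : Set K) =
          Set.range (Polynomial.aeval (R := E) x) := by
        have := IntermediateField.adjoin_simple_toSubalgebra_of_isAlgebraic hx.isAlgebraic
        rw [Algebra.adjoin_singleton_eq_range_aeval] at this
        exact congrArg (fun A : Subalgebra E K => (A : Set K)) this
      rw [hE]
      ext y
      constructor
      · rintro ⟨z, rfl⟩
        obtain ⟨p, rfl⟩ := AdjoinRoot.mk_surjective z
        exact ⟨p.map g, by rw [hφ', hΨ]⟩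
      · rintro ⟨p, rfl⟩
        obtain ⟨p, rfl⟩ := hgms p
        exact ⟨AdjoinRoot.mk f p, by rw [hφ', hΨ]⟩
    · intro z hz
      obtain ⟨p, rfl⟩ := AdjoinRoot.mk_surjective z
      rw [hφ', hΨ] at hz
      obtain ⟨b, hb⟩ := minpoly.dvd E x hz
      obtain ⟨b, rfl⟩ := hgms b
      have h1 : p - f * b ∈ (maximalIdeal R).map (algebraMap R (Polynomial T)) := by
        apply poly_mem_map g _ hgk
        rw [Polynomial.map_sub, Polynomial.map_mul, hb, hf1, sub_self]
      have h2 := Ideal.mem_map_of_mem (AdjoinRoot.mk f) h1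
      rw [Ideal.map_map, map_sub, map_mul, AdjoinRoot.mk_self, zero_mul, sub_zero] at h2
      exact h2
  · have htr : ∀ p : Polynomial E, Polynomial.aeval x p = 0 → p = 0 := by
      have : Transcendental E x := fun h => hx h.isIntegral
      exact fun p hp => (transcendental_iff.1 this) p hp
    let q : Ideal (Polynomial T) := RingHom.ker Ψ
    have hq : q.IsPrime := RingHom.ker_isPrime _
    have hunit : ∀ y : q.primeCompl, IsUnit (Ψ y) := by
      rintro ⟨y, hy⟩
      exact isUnit_iff_ne_zero.2 hy
    have hflat : Module.Flat R (Localization.AtPrime q) :=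
      have : Module.Flat R (Polynomial T) := .trans R T _
      .trans R (Polynomial T) _
    let φ' : Localization.AtPrime q →ₐ[R] K := IsLocalization.liftAlgHom (M := q.primeCompl) hunit
    have hφ' : ∀ p, φ' (algebraMap _ _ p) = Ψ p := fun p => by simp [φ']
    have hmk : ∀ (p : Polynomial T) (s : q.primeCompl),
        φ' (IsLocalization.mk' _ p s) = Ψ p / Ψ s := by
      intro p s
      rw [eq_div_iff (hunit s).ne_zero, ← hφ' s, ← map_mul, IsLocalization.mk'_spec, hφ']
    refine ⟨Localization.AtPrime q, inferInstance, inferInstance, hflat, φ', ?_, ?_⟩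
    · ext y
      rw [SetLike.mem_coe, IntermediateField.mem_adjoin_simple_iff]
      constructor
      · rintro ⟨z, rfl⟩
        obtain ⟨p, s, rfl⟩ := IsLocalization.exists_mk'_eq q.primeCompl z
        exact ⟨p.map g, (s : Polynomial T).map g, by rw [hmk, hΨ, hΨ]⟩
      · rintro ⟨r, s, rfl⟩
        obtain ⟨r, rfl⟩ := hgms r
        obtain ⟨s, rfl⟩ := hgms s
        by_cases hs : Ψ s = 0
        · exact ⟨0, by rw [map_zero, ← hΨ s, hs, div_zero]⟩
        · exact ⟨IsLocalization.mk' _ r ⟨s, hs⟩, by rw [hmk, hΨ, hΨ]⟩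
    · intro z hz
      obtain ⟨p, s, rfl⟩ := IsLocalization.exists_mk'_eq q.primeCompl z
      rw [hmk, div_eq_zero_iff, or_iff_left (hunit s).ne_zero, hΨ] at hz
      have h1 := poly_mem_map g _ hgk p (htr _ hz)
      have h2 := Ideal.mem_map_of_mem (algebraMap (Polynomial T) (Localization.AtPrime q)) h1
      rw [Ideal.map_map, ← IsScalarTower.algebraMap_eq] at h2
      rw [IsLocalization.mk'_eq_mul_mk'_one]
      exact Ideal.mul_mem_right _ _ h2

lemma hasFlatLift_univ [Algebra.EssFiniteType R K] [Algebra (ResidueField R) K]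
    [IsScalarTower R (ResidueField R) K] : HasFlatLift R K Set.univ := by
  have : Algebra.EssFiniteType (ResidueField R) K := .of_comp R _ _
  have hfg : (⊤ : IntermediateField (ResidueField R) K).FG := by
    rw [← IntermediateField.essFiniteType_iff]
    exact (Algebra.EssFiniteType.iff_of_algEquiv
      (IntermediateField.topEquiv (F := ResidueField R) (E := K))).2 this
  have := IntermediateField.induction_on_adjoin_fg
    (fun E : IntermediateField (ResidueField R) K => HasFlatLift R K (E : Set K)) ?_ ?_ ⊤ hfg
  · simpa using this
  · refine ⟨R, inferInstance, inferInstance, inferInstance, Algebra.ofId R K, ?_, ?_⟩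
    · ext y
      rw [SetLike.mem_coe, IntermediateField.mem_bot]
      constructor
      · rintro ⟨r, rfl⟩
        exact ⟨residue R r, (IsScalarTower.algebraMap_apply R (ResidueField R) K r).symm⟩
      · rintro ⟨r, rfl⟩
        obtain ⟨r, rfl⟩ := residue_surjective r
        exact ⟨r, IsScalarTower.algebraMap_apply R (ResidueField R) K r⟩
    · intro t ht
      have h1 : algebraMap R K t = 0 := ht
      rw [IsScalarTower.algebraMap_apply R (ResidueField R) K] at h1
      have h2 : residue R t = 0 := (map_eq_zero _).1 h1
      rw [Algebra.algebraMap_self, Ideal.map_id]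
      exact (residue_eq_zero_iff _).1 h2
  · intro E x h
    exact hasFlatLift_step E x h

end Gonflement


lemma smooth_indep.{w} (R S : Type w) [CommRing R] [CommRing S]
    [IsLocalRing R] [IsLocalRing S] [IsNoetherianRing R]
    [Algebra R S] [IsLocalHom (algebraMap R S)]
    [Algebra.FormallySmooth R S] [Algebra.EssFiniteType R S]
    {ι : Type*} [Fintype ι] (x : ι → R)
    (h : ∀ c : ι → R, ∑ i, c i * x i ∈ maximalIdeal R ^ 2 → ∀ i, c i ∈ maximalIdeal R)
    (a : ι → S) (ha : ∑ i, a i * algebraMap R S (x i) ∈ maximalIdeal S ^ 2) (i : ι) :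
    a i ∈ maximalIdeal S := by
  have : Algebra.EssFiniteType R (ResidueField S) :=
    inferInstanceAs (Algebra.EssFiniteType R (S ⧸ maximalIdeal S))
  obtain ⟨T, _, _, _, φ, hrange, hker⟩ := hasFlatLift_univ (R := R) (K := ResidueField S)
  have hsurj : Function.Surjective φ := by
    rw [← Set.range_eq_univ]; exact hrange
  have hm : ∀ r ∈ maximalIdeal R, algebraMap R (ResidueField S) r = 0 := by
    intro r hr
    rw [IsScalarTower.algebraMap_apply R S (ResidueField S)]
    change residue S _ = 0
    rw [residue_eq_zero_iff]
    exact fun hu => hr (isUnit_of_map_unit (algebraMap R S) r hu)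
  set J : Ideal T := (maximalIdeal R).map (algebraMap R T) with hJ
  have hJφ : ∀ t ∈ J, φ t = 0 := by
    intro t ht
    have : J ≤ RingHom.ker φ := by
      rw [hJ, Ideal.map_le_iff_le_comap]
      intro r hr
      simp [RingHom.mem_ker, hm r hr]
    exact this ht
  set J2 : Ideal T := (maximalIdeal R ^ 2).map (algebraMap R T) with hJ2
  have hJJ : J2 = J ^ 2 := by rw [hJ2, Ideal.map_pow]
  let φb : (T ⧸ J2) →ₐ[R] ResidueField S := Ideal.Quotient.liftₐ J2 φ (fun t ht => hJφ t
    (by rw [hJJ] at ht; exact Ideal.pow_le_self two_ne_zero ht))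
  have hφb : ∀ t, φb (Ideal.Quotient.mk J2 t) = φ t := fun t => rfl
  have hφs : Function.Surjective φb := fun y => by
    obtain ⟨t, rfl⟩ := hsurj y
    exact ⟨Ideal.Quotient.mk J2 t, hφb t⟩
  have hk : RingHom.ker φb ≤ J.map (Ideal.Quotient.mk J2) := by
    intro b hb
    obtain ⟨t, rfl⟩ := Ideal.Quotient.mk_surjective b
    exact Ideal.mem_map_of_mem _ (hker t hb)
  have hk2 : RingHom.ker φb ^ 2 = ⊥ := by
    rw [eq_bot_iff]
    refine (Ideal.pow_right_mono hk 2).trans ?_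
    rw [← Ideal.map_pow, ← hJJ, Ideal.map_quotient_self]
  let s := Algebra.FormallySmooth.liftOfSurjective (IsScalarTower.toAlgHom R S (ResidueField S))
    φb hφs ⟨2, hk2⟩
  have hs : ∀ y, φb (s y) = residue S y := fun y =>
    Algebra.FormallySmooth.liftOfSurjective_apply _ _ hφs ⟨2, hk2⟩ y
  have hs2 : ∀ y ∈ maximalIdeal S ^ 2, s y = 0 := by
    have h1 : maximalIdeal S ≤ (RingHom.ker φb).comap s := by
      intro y hy
      rw [Ideal.mem_comap, RingHom.mem_ker, hs, residue_eq_zero_iff]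
      exact hy
    intro y hy
    have h2 := Ideal.le_comap_pow s 2 (Ideal.pow_right_mono h1 2 hy)
    rw [Ideal.mem_comap, hk2] at h2
    exact h2
  choose t ht using fun i => Ideal.Quotient.mk_surjective (s (a i))
  have key : t i ∈ J := by
    refine flat_indep (maximalIdeal R) x h t ?_ i
    change _ ∈ J2
    rw [← Ideal.Quotient.eq_zero_iff_mem, ← hs2 _ ha]
    simp only [map_sum, map_mul, ht, AlgHom.commutes]
    rfl
  have := hJφ _ key
  rw [← hφb, ht, hs, residue_eq_zero_iff] at this
  exact this

lemma fiber_lift {A F : Type*} [CommRing A] [CommRing F] [IsLocalRing A] [IsLocalRing F]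
    [IsNoetherianRing A] [IsNoetherianRing F] (f : A →+* F) (hf : Function.Surjective f) :
    ∃ y : Fin (embDim F) → A, (∀ j, y j ∈ maximalIdeal A) ∧
      maximalIdeal A ≤ Ideal.span (Set.range y) ⊔ RingHom.ker f ∧
      ∀ b : Fin (embDim F) → A, f (∑ j, b j * y j) ∈ maximalIdeal F ^ 2 →
        ∀ j, b j ∈ maximalIdeal A := by
  have hloc : IsLocalHom f := .of_surjective f hf
  have hmem : ∀ a, f a ∈ maximalIdeal F ↔ a ∈ maximalIdeal A := by
    intro a
    simp [mem_maximalIdeal, mem_nonunits_iff]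
  rw [embDim_eq_spanFinrank F]
  obtain ⟨z, hz, hzi⟩ := exists_min_generators (maximalIdeal F)
  choose y hy using fun j => hf (z j)
  refine ⟨y, fun j => ?_, ?_, ?_⟩
  · rw [← hmem, hy, ← hz]
    exact Ideal.subset_span ⟨j, rfl⟩
  · intro a ha
    rw [← hmem, ← hz] at ha
    have h1 : Ideal.span (Set.range z) = (Ideal.span (Set.range y)).map f := by
      rw [Ideal.map_span, ← Set.range_comp]
      congr 2
      ext j
      exact (hy j).symm
    rw [h1] at ha
    have h2 : a ∈ ((Ideal.span (Set.range y)).map f).comap f := ha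
    rwa [Ideal.comap_map_of_surjective' f hf] at h2
  · intro b hb j
    rw [← hmem]
    refine hzi (fun j => f (b j)) ?_ j
    rw [← sq]
    simpa [hy] using hb

lemma embDim_eq_add.{w} (R S : Type w) [CommRing R] [CommRing S]
    [IsLocalRing R] [IsLocalRing S] [IsNoetherianRing R] [IsNoetherianRing S]
    [Algebra R S] [IsLocalHom (algebraMap R S)]
    [Algebra.FormallySmooth R S] [Algebra.EssFiniteType R S]
    [IsLocalRing (S ⧸ Ideal.map (algebraMap R S) (maximalIdeal R))] :
    embDim S = embDim R + embDim (S ⧸ Ideal.map (algebraMap R S) (maximalIdeal R)) := by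
  set I := Ideal.map (algebraMap R S) (maximalIdeal R) with hI
  have hIm : ∀ r ∈ maximalIdeal R, algebraMap R S r ∈ maximalIdeal S :=
    fun r hr hu => hr (isUnit_of_map_unit (algebraMap R S) r hu)
  have hIn : I ≤ maximalIdeal S := Ideal.map_le_iff_le_comap.mpr hIm
  obtain ⟨y, hy, hys, hyi⟩ := fiber_lift (Ideal.Quotient.mk I) Ideal.Quotient.mk_surjective
  obtain ⟨x, hx, hxi⟩ := exists_min_generators (maximalIdeal R)
  have hxm : ∀ i, x i ∈ maximalIdeal R := fun i => by
    rw [← hx]; exact Ideal.subset_span ⟨i, rfl⟩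
  rw [← sq] at hxi
  rw [Ideal.mk_ker] at hys
  have hspan : maximalIdeal S = Ideal.span (Set.range (Sum.elim (fun i => algebraMap R S (x i)) y)) := by
    have hIs : I = Ideal.span (Set.range (fun i => algebraMap R S (x i))) := by
      have h1 := congrArg (Ideal.map (algebraMap R S)) hx
      rw [Ideal.map_span, ← Set.range_comp] at h1
      exact h1.symm
    rw [Set.Sum.elim_range, Ideal.span_union]
    apply le_antisymm
    · rw [sup_comm, ← hIs]; exact hys
    · rw [← hIs]
      refine sup_le hIn (Ideal.span_le.mpr ?_)
      rintro _ ⟨j, rfl⟩; exact hy j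
  apply le_antisymm
  · rw [embDim_eq_spanFinrank S, hspan, embDim_eq_spanFinrank R]
    refine (Submodule.spanFinrank_span_le_ncard_of_finite (Set.finite_range _)).trans ?_
    rw [← Set.image_univ]
    refine (Set.ncard_image_le Set.finite_univ).trans ?_
    rw [Set.ncard_univ]
    simp
    exact le_rfl
  · have := card_le_embDim (Sum.elim (fun i => algebraMap R S (x i)) y) ?_ ?_
    · rw [embDim_eq_spanFinrank R]; simpa using this
    · rintro (i | j)
      · exact hIm _ (hxm i)
      · exact hy j
    · intro c hc
      simp only [Fintype.sum_sum_type, Sum.elim_inl, Sum.elim_inr] at hc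
      have hb : ∀ j, c (Sum.inr j) ∈ maximalIdeal S := by
        refine hyi _ ?_
        have h1 := Ideal.mem_map_of_mem (Ideal.Quotient.mk I) hc
        rw [Ideal.map_pow, map_add] at h1
        have h2 : Ideal.Quotient.mk I (∑ i, c (Sum.inl i) * algebraMap R S (x i)) = 0 := by
          rw [Ideal.Quotient.eq_zero_iff_mem]
          exact Ideal.sum_mem _ fun i _ => Ideal.mul_mem_left _ _ (Ideal.mem_map_of_mem _ (hxm i))
        rw [h2, zero_add] at h1
        refine Ideal.pow_right_mono ?_ 2 h1
        have hloc : IsLocalHom (Ideal.Quotient.mk I) := .of_surjective _ Ideal.Quotient.mk_surjective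
        exact Ideal.map_le_iff_le_comap.mpr fun s hs hu => hs (isUnit_of_map_unit _ s hu)
      have ha : ∀ i, c (Sum.inl i) ∈ maximalIdeal S := by
        refine smooth_indep R S x hxi _ ?_
        refine (Ideal.add_mem_iff_left _ ?_).mp hc
        rw [sq]
        exact Ideal.sum_mem _ fun j _ => Ideal.mul_mem_mul (hb j) (hy j)
      rintro (i | j)
      exacts [ha i, hb j]

lemma dim_eq_add (R S : Type*) [CommRing R] [CommRing S]
    [IsLocalRing R] [IsLocalRing S] [IsNoetherianRing R] [IsNoetherianRing S]
    [Algebra R S] [IsLocalHom (algebraMap R S)] [Module.Flat R S]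
    [IsLocalRing (S ⧸ Ideal.map (algebraMap R S) (maximalIdeal R))] :
    ringKrullDim S = ringKrullDim R +
      ringKrullDim (S ⧸ Ideal.map (algebraMap R S) (maximalIdeal R)) := by
  have : (maximalIdeal S).LiesOver (maximalIdeal R) := ⟨by
    ext r
    simp [Ideal.mem_comap, mem_maximalIdeal, mem_nonunits_iff]⟩
  have h := Ideal.height_eq_height_add_of_liesOver_of_hasGoingDown (maximalIdeal R) (maximalIdeal S)
  set I := Ideal.map (algebraMap R S) (maximalIdeal R) with hI
  have hmap : (maximalIdeal S).map (Ideal.Quotient.mk I) = maximalIdeal (S ⧸ I) := by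
    have hloc : IsLocalHom (Ideal.Quotient.mk I) := .of_surjective _ Ideal.Quotient.mk_surjective
    have : (maximalIdeal (S ⧸ I)).comap (Ideal.Quotient.mk I) = maximalIdeal S := by
      ext r
      simp [Ideal.mem_comap, mem_maximalIdeal, mem_nonunits_iff]
    rw [← this, Ideal.map_comap_of_surjective _ Ideal.Quotient.mk_surjective]
  rw [hmap] at h
  rw [← maximalIdeal_height_eq_ringKrullDim, ← maximalIdeal_height_eq_ringKrullDim,
    ← maximalIdeal_height_eq_ringKrullDim, h]
  rfl

/-- If `P → F` is a surjection of local rings with kernel `I` such that `P/I² → F` has a ring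
section, then `I ∩ m² ⊆ m I`. -/
lemma inter_sq_le {P F : Type*} [CommRing P] [CommRing F] [IsLocalRing P] [IsLocalRing F]
    (f : P →+* F) (hf : Function.Surjective f)
    (s : F →+* P ⧸ (RingHom.ker f) ^ 2)
    (hs : ∀ p, s (f p) - Ideal.Quotient.mk (RingHom.ker f ^ 2) p ∈
      (RingHom.ker f).map (Ideal.Quotient.mk (RingHom.ker f ^ 2)))
    (z : P) (hz : z ∈ RingHom.ker f) (hz2 : z ∈ maximalIdeal P ^ 2) :
    z ∈ maximalIdeal P * RingHom.ker f := by
  generalize hI : RingHom.ker f = I at *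
  set q := Ideal.Quotient.mk (I ^ 2) with hq
  have hIm : I ≤ maximalIdeal P := hI ▸ le_maximalIdeal (RingHom.ker_ne_top f)
  have hImq : I.map q ≤ (maximalIdeal P).map q := Ideal.map_mono hIm
  have key : ∀ w ∈ maximalIdeal P ^ 2, s (f w) - q w ∈ (maximalIdeal P * I).map q := by
    intro w hw
    rw [sq] at hw
    refine Submodule.mul_induction_on hw ?_ ?_
    · intro a ha b hb
      have e : s (f (a * b)) - q (a * b) =
          q a * (s (f b) - q b) + q b * (s (f a) - q a)
            + (s (f a) - q a) * (s (f b) - q b) := by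
        simp only [map_mul]; ring
      rw [e, Ideal.map_mul]
      exact add_mem (add_mem (Ideal.mul_mem_mul (Ideal.mem_map_of_mem _ ha) (hs b))
        (Ideal.mul_mem_mul (Ideal.mem_map_of_mem _ hb) (hs a)))
        (Ideal.mul_mem_mul (hImq (hs a)) (hs b))
    · intro a b ha hb
      have e : s (f (a + b)) - q (a + b) = (s (f a) - q a) + (s (f b) - q b) := by
        simp only [map_add]; ring
      rw [e]
      exact add_mem ha hb
  have h1 := key z hz2
  rw [RingHom.mem_ker.mp (hI.symm ▸ hz : z ∈ RingHom.ker f), map_zero, zero_sub, neg_mem_iff] at h1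
  have h2 : z ∈ ((maximalIdeal P * I).map q).comap q := h1
  rw [Ideal.comap_map_of_surjective' q Ideal.Quotient.mk_surjective, hq, Ideal.mk_ker, sq] at h2
  exact sup_le le_rfl (Ideal.mul_mono_left hIm) h2

lemma embDim_eq_of_section {P F : Type*} [CommRing P] [CommRing F] [IsLocalRing F]
    [IsNoetherianRing F] [IsRegularLocalRing P]
    (f : P →+* F) (hf : Function.Surjective f)
    (s : F →+* P ⧸ (RingHom.ker f) ^ 2)
    (hs : ∀ p, s (f p) - Ideal.Quotient.mk (RingHom.ker f ^ 2) p ∈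
      (RingHom.ker f).map (Ideal.Quotient.mk (RingHom.ker f ^ 2))) :
    (embDim F : WithBot ℕ∞) = ringKrullDim F := by
  have hloc : IsLocalHom f := .of_surjective f hf
  have hinter := inter_sq_le f hf s hs
  obtain ⟨y, hy, -, hyi⟩ := fiber_lift f hf
  obtain ⟨z, hzs, hzi⟩ := exists_min_generators (RingHom.ker f)
  have hzI : ∀ i, z i ∈ RingHom.ker f := fun i => by
    have := Ideal.subset_span (Set.mem_range_self (f := z) i)
    exact hzs.le this
  have hIm : RingHom.ker f ≤ maximalIdeal P := le_maximalIdeal (RingHom.ker_ne_top f)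
  have hmap : (maximalIdeal P).map f ≤ maximalIdeal F :=
    Ideal.map_le_iff_le_comap.mpr fun s hs hu => hs (isUnit_of_map_unit _ s hu)
  have h1 := card_le_embDim (Sum.elim y z) (by
    rintro (j | i)
    exacts [hy j, hIm (hzI i)]) (by
    intro c hc
    simp only [Fintype.sum_sum_type, Sum.elim_inl, Sum.elim_inr] at hc
    have hzc : ∑ i, c (Sum.inr i) * z i ∈ RingHom.ker f :=
      Ideal.sum_mem _ fun i _ => Ideal.mul_mem_left _ _ (hzI i)
    have hb : ∀ j, c (Sum.inl j) ∈ maximalIdeal P := by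
      refine hyi _ ?_
      have h1 := Ideal.mem_map_of_mem f hc
      rw [Ideal.map_pow, map_add, RingHom.mem_ker.mp hzc, add_zero] at h1
      exact Ideal.pow_right_mono hmap 2 h1
    have ha : ∀ i, c (Sum.inr i) ∈ maximalIdeal P := by
      refine hzi (fun i => c (Sum.inr i)) (hinter _ hzc ?_)
      refine (Ideal.add_mem_iff_right _ ?_).mp hc
      rw [sq]
      exact Ideal.sum_mem _ fun j _ => Ideal.mul_mem_mul (hb j) (hy j)
    rintro (j | i)
    exacts [hb j, ha i])
  have hP : (embDim P : WithBot ℕ∞) = ringKrullDim P := by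
    rw [embDim_eq_spanFinrank]
    exact IsRegularLocalRing.spanFinrank_maximalIdeal
  have h2 := ringKrullDim_le_ringKrullDim_quotient_add_spanFinrank (RingHom.ker f)
    (by rw [IsLocalRing.ringJacobson_eq_maximalIdeal]; exact hIm)
  rw [ringKrullDim_eq_of_ringEquiv (RingHom.quotientKerEquivOfSurjective hf), ← hP] at h2
  apply le_antisymm
  · simp only [Fintype.card_sum, Fintype.card_fin] at h1
    have h3 : ((embDim F + (RingHom.ker f).spanFinrank : ℕ) : WithBot ℕ∞) ≤
      ringKrullDim F + (RingHom.ker f).spanFinrank := (by exact_mod_cast h1 : _ ≤ (embDim P : WithBot ℕ∞)).trans h2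
    rw [← maximalIdeal_height_eq_ringKrullDim] at h3 ⊢
    generalize (maximalIdeal F).height = d at *
    generalize (RingHom.ker f).spanFinrank = e at *
    have h4 : ((embDim F : ℕ∞) + e) ≤ d + e := by exact_mod_cast h3
    have := (ENat.add_le_add_iff_right (ENat.natCast_ne_top e)).mp h4
    exact_mod_cast this
  · rw [embDim_eq_spanFinrank]
    exact ringKrullDim_le_spanFinrank_maximalIdeal F

lemma exists_section (R S : Type*) [CommRing R] [CommRing S] [Algebra R S]
    [Algebra.FormallySmooth R S] (m : Ideal R) (P : Type*) [CommRing P] [Algebra (R ⧸ m) P]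
    (f : P →ₐ[R ⧸ m] S ⧸ m.map (algebraMap R S)) (hf : Function.Surjective f) :
    ∃ s : S ⧸ m.map (algebraMap R S) →+* P ⧸ (RingHom.ker f.toRingHom) ^ 2,
      ∀ p, s (f.toRingHom p) - Ideal.Quotient.mk (RingHom.ker f.toRingHom ^ 2) p ∈
      (RingHom.ker f.toRingHom).map (Ideal.Quotient.mk (RingHom.ker f.toRingHom ^ 2)) := by
  let _ : Algebra R P := ((algebraMap (R ⧸ m) P).comp (Ideal.Quotient.mk m)).toAlgebra
  have : IsScalarTower R (R ⧸ m) P := .of_algebraMap_eq' rfl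
  have hmP : ∀ r ∈ m, algebraMap R P r = 0 := by
    intro r hr
    rw [IsScalarTower.algebraMap_apply R (R ⧸ m) P, Ideal.Quotient.algebraMap_eq,
      Ideal.Quotient.eq_zero_iff_mem.mpr hr, map_zero]
  set I := RingHom.ker f.toRingHom with hI
  let g : (P ⧸ I ^ 2) →ₐ[R] S ⧸ m.map (algebraMap R S) :=
    Ideal.Quotient.liftₐ (I ^ 2) (f.restrictScalars R)
      (fun t ht => (Ideal.pow_le_self two_ne_zero ht : t ∈ I))
  have hg : ∀ p, g (Ideal.Quotient.mk _ p) = f p := fun p => rfl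
  have hgs : Function.Surjective g := fun y => by
    obtain ⟨t, rfl⟩ := hf y
    exact ⟨Ideal.Quotient.mk _ t, hg t⟩
  have hk : RingHom.ker g ≤ I.map (Ideal.Quotient.mk (I ^ 2)) := by
    intro b hb
    obtain ⟨t, rfl⟩ := Ideal.Quotient.mk_surjective b
    exact Ideal.mem_map_of_mem _ hb
  have hk2 : RingHom.ker g ^ 2 = ⊥ := by
    rw [eq_bot_iff]
    refine (Ideal.pow_right_mono hk 2).trans ?_
    rw [← Ideal.map_pow, Ideal.map_quotient_self]
  let s0 := Algebra.FormallySmooth.liftOfSurjective (Ideal.Quotient.mkₐ R (m.map (algebraMap R S)))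
    g hgs ⟨2, hk2⟩
  have hs0 : ∀ y, g (s0 y) = Ideal.Quotient.mk _ y := fun y =>
    Algebra.FormallySmooth.liftOfSurjective_apply _ _ hgs ⟨2, hk2⟩ y
  have hkill : m.map (algebraMap R S) ≤ RingHom.ker s0.toRingHom := by
    rw [Ideal.map_le_iff_le_comap]
    intro r hr
    rw [Ideal.mem_comap, RingHom.mem_ker]
    change s0 (algebraMap R S r) = 0
    rw [AlgHom.commutes, IsScalarTower.algebraMap_apply R P (P ⧸ I ^ 2), hmP r hr, map_zero]
  refine ⟨Ideal.Quotient.lift _ s0.toRingHom (fun a ha => hkill ha), fun p => hk ?_⟩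
  rw [RingHom.mem_ker, map_sub, hg, sub_eq_zero]
  obtain ⟨y, hy⟩ := Ideal.Quotient.mk_surjective (f p)
  change g (Ideal.Quotient.lift _ s0.toRingHom (fun a ha => hkill ha) (f p)) = f p
  rw [← hy]
  exact hs0 y

lemma fiber_regular (R S : Type*) [CommRing R] [CommRing S]
    [IsLocalRing R] [IsLocalRing S] [IsNoetherianRing S]
    [Algebra R S]
    [Algebra.FormallySmooth R S] [Algebra.EssFiniteType R S]
    [IsLocalRing (S ⧸ Ideal.map (algebraMap R S) (maximalIdeal R))] :
    (embDim (S ⧸ Ideal.map (algebraMap R S) (maximalIdeal R)) : WithBot ℕ∞) =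
      ringKrullDim (S ⧸ Ideal.map (algebraMap R S) (maximalIdeal R)) := by
  have : Algebra.EssFiniteType (R ⧸ maximalIdeal R) (S ⧸ Ideal.map (algebraMap R S) (maximalIdeal R)) :=
    .of_comp R _ _
  obtain ⟨n, q, hq, f, hf⟩ := exists_surj_localization (R ⧸ maximalIdeal R)
    (S ⧸ Ideal.map (algebraMap R S) (maximalIdeal R))
  have hreg : IsRegularLocalRing (Localization.AtPrime q) := by
    let _ : Field (R ⧸ maximalIdeal R) := Ideal.Quotient.field _
    have : IsRegularRing (MvPolynomial (Fin n) (R ⧸ maximalIdeal R)) :=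
      MvPolynomial.isRegularRing_of_isRegularRing _
    exact IsRegularRing.isRegularLocalRing_localization q
  obtain ⟨s, hs⟩ := exists_section R S (maximalIdeal R) _ f hf
  exact embDim_eq_of_section f.toRingHom hf s hs

/-- An essentially smooth local homomorphism `(R,m) → (S,n)` of Noetherian local rings
(formally smooth and essentially of finite type) preserves the embedding codimension
`ecodim = edim − dim`. More precisely, with `F = S ⊗_R R/m` the closed fiber:
`edim(S) = edim(R) + edim(F)`, `dim(S) = dim(R) + dim(F)`, the fiber `F` is regular
(its embedding dimension equals its dimension), and consequently
`ecodim(S) = ecodim(R)`, i.e. `edim(S) + dim(R) = edim(R) + dim(S)`. -/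
theorem ecodim_eq_of_essentially_smooth
    (R S : Type u) [CommRing R] [CommRing S]
    [IsLocalRing R] [IsLocalRing S] [IsNoetherianRing R] [IsNoetherianRing S]
    [Algebra R S] [IsLocalHom (algebraMap R S)]
    [Algebra.FormallySmooth R S] [Algebra.EssFiniteType R S]
    [IsLocalRing (S ⧸ Ideal.map (algebraMap R S) (maximalIdeal R))] :
    embDim S = embDim R + embDim (S ⧸ Ideal.map (algebraMap R S) (maximalIdeal R)) ∧
    Order.krullDim (PrimeSpectrum S) = Order.krullDim (PrimeSpectrum R) +
      Order.krullDim (PrimeSpectrum (S ⧸ Ideal.map (algebraMap R S) (maximalIdeal R))) ∧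
    (embDim (S ⧸ Ideal.map (algebraMap R S) (maximalIdeal R)) : WithBot ℕ∞) =
      Order.krullDim (PrimeSpectrum (S ⧸ Ideal.map (algebraMap R S) (maximalIdeal R))) ∧
    (embDim S : WithBot ℕ∞) + Order.krullDim (PrimeSpectrum R) =
      (embDim R : WithBot ℕ∞) + Order.krullDim (PrimeSpectrum S) := by
  have : Module.Flat R S := flat_of_formallySmooth_essFiniteType R S
  have h1 := embDim_eq_add R S
  have h2 := dim_eq_add R S
  have h3 := fiber_regular R S
  refine ⟨h1, h2, h3, ?_⟩
  change (embDim S : WithBot ℕ∞) + ringKrullDim R = (embDim R : WithBot ℕ∞) + ringKrullDim S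
  rw [h1, h2, Nat.cast_add, h3, add_assoc, add_comm (ringKrullDim R)]
end

section
/- Let k be a perfect field, R = k[x₁,...,x_n], I = (f₁,...,f_s) ⊂ R, S = R/I, and 𝔮 a prime of S with residue field L. Let Df(𝔮) denote the Jacobian matrix (∂f_i/∂x_j) evaluated in L at 𝔮. Then ecodim(S_𝔮) = height(I·R_𝔭) − rank_L(Df(𝔮)), where 𝔭 ⊂ R is the preimage of 𝔮 and ecodim(S_𝔮) = edim(S_𝔮) − dim(S_𝔮). -/
open IsLocalRing

/-- The height of an ideal: the infimum of the heights of the primes containing it. -/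
noncomputable def idealHeight {R : Type*} [CommRing R] (I : Ideal R) : ℕ∞ :=
  ⨅ (p : PrimeSpectrum R) (_ : I ≤ p.asIdeal), Order.height p

theorem aux_prime_height {R : Type*} [CommRing R] (P : Ideal R) [h : P.IsPrime] :
    P.height = Order.height (⟨P, h⟩ : PrimeSpectrum R) :=
  PrimeSpectrum.height_eq_orderHeight ⟨P, h⟩

theorem aux_chain {α β : Type*} [Preorder α] [Preorder β] (f : α → β) (hf : StrictMono f)
    (l : LTSeries α) : Order.height (f l.head) + l.length ≤ Order.height (f l.last) := by
  have key : ∀ (i : ℕ) (hi : i < l.length + 1),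
      Order.height (f l.head) + i ≤ Order.height (f (l ⟨i, hi⟩)) := by
    intro i
    induction i with
    | zero => intro hi; simp [RelSeries.head]
    | succ i ih =>
      intro hi
      have h1 := ih (by omega)
      have h2 : l ⟨i, by omega⟩ < l ⟨i + 1, hi⟩ := l.strictMono (by simp [Fin.lt_def])
      have h3 := Order.height_add_one_le (hf h2)
      refine le_trans ?_ h3
      push_cast
      rw [← add_assoc]
      gcongr
  exact key l.length (by omega)

theorem aux_ringKrullDim_integral (A C : Type*) [CommRing A] [CommRing C] [Algebra A C]
    [Algebra.IsIntegral A C] [FaithfulSMul A C] : ringKrullDim C = ringKrullDim A := by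
  apply le_antisymm
  · apply Order.krullDim_le_of_strictMono (PrimeSpectrum.comap (algebraMap A C))
    intro P Q h
    exact Ideal.IsIntegral.comap_lt_comap h
  · refine iSup_le fun l => ?_
    have : Nonempty (PrimeSpectrum.comap (algebraMap A C) ⁻¹' {l.head}) := by
      obtain ⟨Q, -, hQ, hQ'⟩ := Ideal.exists_ideal_over_prime_of_isIntegral (S := C)
        l.head.asIdeal ⊥
        (by rw [← RingHom.ker_eq_comap_bot, (RingHom.injective_iff_ker_eq_bot _).1
              (FaithfulSMul.algebraMap_injective A C)]; exact bot_le)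
      exact ⟨⟨⟨Q, hQ⟩, PrimeSpectrum.ext hQ'⟩⟩
    obtain ⟨⟨Q, hQ⟩⟩ := this
    have : Q.asIdeal.LiesOver (RelSeries.head l).asIdeal := ⟨by
      have := congrArg PrimeSpectrum.asIdeal hQ
      exact this.symm⟩
    obtain ⟨L, hL, -⟩ := Ideal.exists_ltSeries_of_hasGoingUp l Q.asIdeal
    rw [← hL]
    exact Order.LTSeries.length_le_krullDim L

theorem aux_height_integral (A C : Type*) [CommRing A] [CommRing C] [Algebra A C]
    [IsNoetherianRing A] [IsNoetherianRing C] [Algebra.IsIntegral A C] [Algebra.HasGoingDown A C]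
    (P : Ideal C) [P.IsPrime] : P.height = (P.under A).height := by
  apply le_antisymm
  · rw [aux_prime_height, aux_prime_height]
    exact Order.height_le_height_apply_of_strictMono (PrimeSpectrum.comap (algebraMap A C))
      (fun P Q h => Ideal.IsIntegral.comap_lt_comap h) ⟨P, ‹_›⟩
  · rw [Ideal.height_eq_height_add_of_liesOver_of_hasGoingDown (P.under A) P]
    exact le_self_add

theorem aux_transfer (A C : Type*) [CommRing A] [CommRing C] [Algebra A C] [IsNoetherianRing A]
    [IsNoetherianRing C] [IsDomain C] [IsIntegrallyClosed A] [FaithfulSMul A C]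
    [Algebra.IsIntegral A C] (P : Ideal C) [P.IsPrime] :
    P.height + ringKrullDim (C ⧸ P) = (P.under A).height + ringKrullDim (A ⧸ P.under A) := by
  rw [aux_height_integral A C, aux_ringKrullDim_integral (A ⧸ P.under A) (C ⧸ P)]

theorem aux_height_max (k : Type*) [Field k] (n : ℕ) (m : Ideal (MvPolynomial (Fin n) k))
    [m.IsMaximal] : m.height = n := by
  induction n with
  | zero =>
    have h := Ideal.height_le_ringKrullDim_of_isPrime (I := m)
    rw [MvPolynomial.ringKrullDim_of_isNoetherianRing] at h
    simp at h
    simpa using h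
  | succ n ih =>
    let e := (MvPolynomial.finSuccEquiv k n).toRingEquiv
    let P := m.comap e.symm
    have hP : P.IsMaximal := Ideal.comap_isMaximal_of_equiv e.symm
    have h1 : (P.comap Polynomial.C).IsMaximal :=
      Polynomial.isMaximal_comap_C_of_isJacobsonRing P
    have h0 : P.LiesOver (P.comap Polynomial.C) := ⟨rfl⟩
    have h2 := Polynomial.height_eq_height_add_one (P.comap Polynomial.C) P
    rw [ih (P.comap _), RingEquiv.height_comap] at h2
    exact_mod_cast h2

theorem aux_dim_le {R : Type*} [CommRing R] (P : Ideal R) [P.IsPrime] :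
    P.height + ringKrullDim (R ⧸ P) ≤ ringKrullDim R := by
  have hne : Nonempty (PrimeSpectrum (R ⧸ P)) := inferInstance
  have hne' : Nonempty (PrimeSpectrum R) := ⟨⟨P, ‹_›⟩⟩
  rw [ringKrullDim, Order.krullDim_eq_iSup_length, ← WithBot.coe_add, ENat.add_iSup]
  rw [ringKrullDim, Order.krullDim_eq_iSup_height_of_nonempty (α := PrimeSpectrum R)]
  · rw [WithBot.coe_le_coe]
    refine iSup_le fun l => ?_
    refine le_trans ?_ (le_trans (aux_chain (PrimeSpectrum.comap (Ideal.Quotient.mk P))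
      (RingHom.strictMono_comap_of_surjective Ideal.Quotient.mk_surjective) l) (le_iSup _ _))
    gcongr
    rw [aux_prime_height]
    apply Order.height_mono
    intro x hx
    change Ideal.Quotient.mk P x ∈ (RelSeries.head l).asIdeal
    rw [Ideal.Quotient.eq_zero_iff_mem.2 hx]
    exact zero_mem _

theorem aux_nat_of_le {x : WithBot ℕ∞} {n : ℕ} (h0 : 0 ≤ x) (hn : x ≤ n) : ∃ m : ℕ, x = m := by
  induction x with
  | bot => simp at h0
  | coe x =>
    induction x with
    | top => exact absurd (top_le_iff.1 (WithBot.coe_le_coe.1 hn)) (ENat.natCast_ne_top n)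
    | coe x => exact ⟨x, rfl⟩

theorem aux_dim_formula_poly (k : Type*) [Field k] (n : ℕ) (P : Ideal (MvPolynomial (Fin n) k))
    [P.IsPrime] : P.height + ringKrullDim (MvPolynomial (Fin n) k ⧸ P) = n := by
  induction n using Nat.strong_induction_on with
  | _ n ih =>
  have hdim : ringKrullDim (MvPolynomial (Fin n) k) = n := by
    rw [MvPolynomial.ringKrullDim_of_isNoetherianRing]; simp
  by_cases hP : P = ⊥
  · subst hP
    rw [Ideal.height_bot, ringKrullDim_eq_of_ringEquiv (RingEquiv.quotientBot _), hdim]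
    simp
  apply le_antisymm
  · rw [← hdim]; exact aux_dim_le P
  · obtain ⟨g, hgP, hg⟩ := Ideal.IsPrime.exists_mem_prime_of_ne_bot ‹P.IsPrime› hP
    let J := Ideal.span {g}
    have hJ : J.IsPrime := (Ideal.span_singleton_prime hg.ne_zero).2 hg
    have hJP : J ≤ P := by simpa [J, Ideal.span_le] using hgP
    obtain ⟨s, φ, hφ, hφi⟩ := exists_integral_inj_algHom_of_fg k (MvPolynomial (Fin n) k ⧸ J)
    have d1 : ringKrullDim (MvPolynomial (Fin n) k ⧸ J) + 1 ≤ n := by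
      rw [← hdim]
      exact ringKrullDim_quotient_succ_le_of_nonZeroDivisor
        (mem_nonZeroDivisors_of_ne_zero hg.ne_zero)
    have d2 : (n : WithBot ℕ∞) ≤ ringKrullDim (MvPolynomial (Fin n) k ⧸ J) + 1 := by
      obtain ⟨m, hm, hJm⟩ := Ideal.exists_le_maximal J hJ.ne_top
      have := Ideal.height_le_ringKrullDim_quotient_add_one (r := g) (p := m)
        (hJm (Ideal.mem_span_singleton_self g))
      rwa [aux_height_max] at this
    algebraize [φ.toRingHom]
    have : FaithfulSMul (MvPolynomial (Fin s) k) (MvPolynomial (Fin n) k ⧸ J) :=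
      (faithfulSMul_iff_algebraMap_injective _ _).2 hφ
    have d3 := aux_ringKrullDim_integral (MvPolynomial (Fin s) k) (MvPolynomial (Fin n) k ⧸ J)
    rw [MvPolynomial.ringKrullDim_of_isNoetherianRing] at d3
    simp at d3
    rw [d3] at d1 d2
    have hs1 : s + 1 ≤ n := by exact_mod_cast d1
    have hs2 : n ≤ s + 1 := by exact_mod_cast d2
    let P' := P.map (Ideal.Quotient.mk J)
    have hP' : P'.IsPrime := Ideal.isPrime_map_quotientMk_of_isPrime hJP
    have t := aux_transfer (MvPolynomial (Fin s) k) (MvPolynomial (Fin n) k ⧸ J) P'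
    rw [ih s (by omega), ringKrullDim_eq_of_ringEquiv (DoubleQuot.quotQuotEquivQuotOfLE hJP)] at t
    have hh : P'.height + 1 ≤ P.height := by
      have hc : P'.comap (Ideal.Quotient.mk J) = P := by
        rw [Ideal.comap_map_of_surjective _ Ideal.Quotient.mk_surjective]
        rw [← RingHom.ker_eq_comap_bot, Ideal.mk_ker]
        exact sup_eq_left.2 hJP
      rw [aux_prime_height P', aux_prime_height P]
      have : Order.height (⟨P', hP'⟩ : PrimeSpectrum _) ≠ ⊤ := by
        rw [← aux_prime_height]; exact Ideal.height_ne_top hP'.ne_top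
      obtain ⟨a, ha⟩ := ENat.ne_top_iff_exists.1 this
      obtain ⟨l, hl, hl2⟩ := Order.exists_series_of_height_eq_coe _ ha.symm
      have := aux_chain (PrimeSpectrum.comap (Ideal.Quotient.mk J))
        (RingHom.strictMono_comap_of_surjective Ideal.Quotient.mk_surjective) l
      rw [hl] at this
      have e1 : PrimeSpectrum.comap (Ideal.Quotient.mk J) ⟨P', hP'⟩ = ⟨P, ‹_›⟩ :=
        PrimeSpectrum.ext hc
      rw [e1, hl2] at this
      rw [← ha, add_comm]
      refine le_trans ?_ this
      gcongr
      rw [Order.one_le_iff_ne_zero]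
      intro h0
      rw [← PrimeSpectrum.height_eq_orderHeight, Ideal.height_eq_zero_iff_eq_bot] at h0
      have : g ∈ ((PrimeSpectrum.comap (Ideal.Quotient.mk J)) (RelSeries.head l)).asIdeal := by
        change Ideal.Quotient.mk J g ∈ (RelSeries.head l).asIdeal
        rw [Ideal.Quotient.eq_zero_iff_mem.2 (Ideal.mem_span_singleton_self g)]
        exact zero_mem _
      rw [h0] at this
      exact hg.ne_zero (by simpa using this)
    have : n = s + 1 := by omega
    have hn' : (n : WithBot ℕ∞) = s + 1 := by exact_mod_cast this
    refine hn'.trans_le ?_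
    rw [← t, add_right_comm]
    gcongr
    exact_mod_cast hh

theorem aux_dim_formula (k A : Type*) [Field k] [CommRing A] [IsDomain A] [Algebra k A]
    [Algebra.FiniteType k A] (P : Ideal A) [P.IsPrime] :
    P.height + ringKrullDim (A ⧸ P) = ringKrullDim A := by
  obtain ⟨s, φ, hφ, hφi⟩ := exists_integral_inj_algHom_of_fg k A
  have : IsNoetherianRing A := Algebra.FiniteType.isNoetherianRing k A
  algebraize [φ.toRingHom]
  have : FaithfulSMul (MvPolynomial (Fin s) k) A :=
    (faithfulSMul_iff_algebraMap_injective _ _).2 hφ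
  have d3 := aux_ringKrullDim_integral (MvPolynomial (Fin s) k) A
  rw [MvPolynomial.ringKrullDim_of_isNoetherianRing] at d3
  simp at d3
  rw [aux_transfer (MvPolynomial (Fin s) k) A P, aux_dim_formula_poly, d3]

theorem aux_catenary (k : Type*) [Field k] (n : ℕ) (P p : Ideal (MvPolynomial (Fin n) k))
    [P.IsPrime] [p.IsPrime] (h : P ≤ p) :
    p.height ≤ P.height + (p.map (Ideal.Quotient.mk P)).height := by
  let p' := p.map (Ideal.Quotient.mk P)
  have hp' : p'.IsPrime := Ideal.isPrime_map_quotientMk_of_isPrime h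
  have h1 := aux_dim_formula_poly k n P
  have h2 := aux_dim_formula_poly k n p
  have h3 := aux_dim_formula k _ p'
  rw [ringKrullDim_eq_of_ringEquiv (DoubleQuot.quotQuotEquivQuotOfLE h)] at h3
  rw [← h3] at h1
  obtain ⟨a, ha⟩ := aux_nat_of_le (x := ringKrullDim (MvPolynomial (Fin n) k ⧸ p)) (n := n)
    ringKrullDim_nonneg_of_nontrivial (by
      rw [← h2]; exact le_add_of_nonneg_left (WithBot.coe_le_coe.2 bot_le))
  rw [ha] at h1 h2
  change p.height ≤ P.height + p'.height
  obtain ⟨x, hx⟩ := ENat.ne_top_iff_exists.1 (Ideal.height_ne_top (I := P) Ideal.IsPrime.ne_top')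
  obtain ⟨y, hy⟩ := ENat.ne_top_iff_exists.1 (Ideal.height_ne_top (I := p) Ideal.IsPrime.ne_top')
  obtain ⟨z, hz⟩ := ENat.ne_top_iff_exists.1 (Ideal.height_ne_top (I := p') Ideal.IsPrime.ne_top')
  rw [← hx, ← hz] at h1
  rw [← hy] at h2
  rw [← hx, ← hy, ← hz]
  have h1' : x + (z + a) = n := by exact_mod_cast h1
  have h2' : y + a = n := by exact_mod_cast h2
  have : y ≤ x + z := by omega
  exact_mod_cast this

theorem aux_height_sum (k : Type*) [Field k] (n : ℕ) (I : Ideal (MvPolynomial (Fin n) k))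
    (𝔮 : Ideal (MvPolynomial (Fin n) k ⧸ I)) [𝔮.IsPrime]
    (𝔭 : Ideal (MvPolynomial (Fin n) k)) (h𝔭 : 𝔭 = Ideal.comap (Ideal.Quotient.mk I) 𝔮)
    [𝔭.IsPrime] :
    idealHeight (I.map (algebraMap (MvPolynomial (Fin n) k) (Localization.AtPrime 𝔭)))
      + 𝔮.height = 𝔭.height := by
  have hI : I ≤ 𝔭 := by
    rw [h𝔭]; intro x hx
    rw [Ideal.mem_comap, Ideal.Quotient.eq_zero_iff_mem.2 hx]
    exact zero_mem _
  apply le_antisymm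
  · obtain ⟨a, ha⟩ := ENat.ne_top_iff_exists.1 (Ideal.height_ne_top (I := 𝔮) Ideal.IsPrime.ne_top')
    rw [aux_prime_height 𝔮] at ha ⊢
    obtain ⟨l, hl, hl2⟩ := Order.exists_series_of_height_eq_coe _ ha.symm
    have := aux_chain (PrimeSpectrum.comap (Ideal.Quotient.mk I))
      (RingHom.strictMono_comap_of_surjective Ideal.Quotient.mk_surjective) l
    have e1 : PrimeSpectrum.comap (Ideal.Quotient.mk I) ⟨𝔮, ‹_›⟩ = ⟨𝔭, ‹_›⟩ :=
        PrimeSpectrum.ext h𝔭.symm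
    have hle : (PrimeSpectrum.comap (Ideal.Quotient.mk I) l.head).asIdeal ≤ 𝔭 := by
      have h5 : l.head ≤ l.last := l.head_le_last
      rw [hl] at h5
      rw [h𝔭]
      exact Ideal.comap_mono h5
    rw [hl, e1, hl2] at this
    rw [← ha, aux_prime_height 𝔭]
    refine le_trans ?_ this
    gcongr
    set P := PrimeSpectrum.comap (Ideal.Quotient.mk I) l.head with hPdef
    have hIP : I ≤ P.asIdeal := by
      intro x hx
      change Ideal.Quotient.mk I x ∈ (RelSeries.head l).asIdeal
      rw [Ideal.Quotient.eq_zero_iff_mem.2 hx]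
      exact zero_mem _
    have hdisj : Disjoint (𝔭.primeCompl : Set (MvPolynomial (Fin n) k)) P.asIdeal := by
      rw [Set.disjoint_left]
      intro x hx hx'
      exact hx (hle hx')
    have hpr : (P.asIdeal.map (algebraMap _ (Localization.AtPrime 𝔭))).IsPrime :=
      IsLocalization.isPrime_of_isPrime_disjoint 𝔭.primeCompl _ _ P.2 hdisj
    refine le_trans (iInf₂_le ⟨_, hpr⟩ (Ideal.map_mono hIP)) ?_
    rw [← aux_prime_height, IsLocalization.height_map_of_disjoint 𝔭.primeCompl _ hdisj,
      PrimeSpectrum.height_eq_orderHeight]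
  · rw [idealHeight]
    rw [ENat.iInf_add]
    refine le_iInf fun Q => ?_
    rw [ENat.iInf_add]
    refine le_iInf fun hQ => ?_
    let P := Q.asIdeal.under (MvPolynomial (Fin n) k)
    have hP𝔭 : P ≤ 𝔭 := by
      have h1 := Ideal.comap_mono (f := algebraMap (MvPolynomial (Fin n) k) (Localization.AtPrime 𝔭))
        (IsLocalRing.le_maximalIdeal_of_isPrime Q.asIdeal)
      exact h1.trans_eq Localization.AtPrime.under_maximalIdeal
    have hIP : I ≤ P := Ideal.map_le_iff_le_comap.1 hQ
    refine (aux_catenary k n P 𝔭 hP𝔭).trans ?_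
    rw [IsLocalization.height_under 𝔭.primeCompl, PrimeSpectrum.height_eq_orderHeight]
    gcongr
    have hp' : (𝔭.map (Ideal.Quotient.mk P)).IsPrime := Ideal.isPrime_map_quotientMk_of_isPrime hP𝔭
    rw [aux_prime_height, aux_prime_height]
    have := Order.height_le_height_apply_of_strictMono
      (PrimeSpectrum.comap (Ideal.Quotient.factor hIP))
      (RingHom.strictMono_comap_of_surjective (Ideal.Quotient.factor_surjective hIP)) ⟨_, hp'⟩
    have e2 : (⟨𝔮, ‹_›⟩ : PrimeSpectrum _) =
        PrimeSpectrum.comap (Ideal.Quotient.factor hIP) ⟨_, hp'⟩ := by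
      apply PrimeSpectrum.ext
      apply Ideal.comap_injective_of_surjective _ (Ideal.Quotient.mk_surjective (I := I))
      change _ = Ideal.comap _ (Ideal.comap _ _)
      rw [Ideal.comap_comap, Ideal.Quotient.factor_comp_mk, ← h𝔭,
        Ideal.comap_map_of_surjective _ Ideal.Quotient.mk_surjective]
      rw [← RingHom.ker_eq_comap_bot, Ideal.mk_ker]
      exact (sup_eq_left.2 hP𝔭).symm
    rw [e2]
    exact this

section
open TensorProduct KaehlerDifferential

theorem aux_E (k A : Type*) [Field k] [PerfectField k] [CommRing A] [IsLocalRing A]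
    [IsNoetherianRing A]
    [Algebra k A] [Algebra.EssFiniteType k A] :
    Module.finrank (ResidueField A) (CotangentSpace A) +
      Module.finrank (ResidueField A) (Ω[ResidueField A⁄k]) =
      Module.finrank (ResidueField A) (ResidueField A ⊗[A] Ω[A⁄k]) := by
  have hs : Function.Surjective (algebraMap A (ResidueField A)) := residue_surjective
  have : Algebra.EssFiniteType A (ResidueField A) := inferInstance
  have : Algebra.EssFiniteType k (ResidueField A) := Algebra.EssFiniteType.comp k A _
  have : Algebra.FormallySmooth k (ResidueField A) := Algebra.FormallySmooth.of_perfectField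
  have hsec : ∃ g, (IsScalarTower.toAlgHom k A (ResidueField A)).kerSquareLift.comp g
      = AlgHom.id k _ := by
    have hs' : Function.Surjective (IsScalarTower.toAlgHom k A (ResidueField A)).kerSquareLift :=
      Function.Surjective.of_comp (g := Ideal.Quotient.mk _) hs
    have hn : IsNilpotent (RingHom.ker (IsScalarTower.toAlgHom k A (ResidueField A)).kerSquareLift) := by
      refine ⟨2, ?_⟩
      have := (IsScalarTower.toAlgHom k A (ResidueField A)).ker_kerSquareLift
      erw [this, Ideal.cotangentIdeal_square]
      rfl
    exact ⟨Algebra.FormallySmooth.liftOfSurjective (AlgHom.id k _) _ hs' hn,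
      Algebra.FormallySmooth.comp_liftOfSurjective _ _ hs' hn⟩
  obtain ⟨g, hg⟩ := hsec
  obtain ⟨l, hl⟩ := (retractionKerCotangentToTensorEquivSection (R := k) hs).symm ⟨g, hg⟩
  have hinj : Function.Injective (kerCotangentToTensor k A (ResidueField A)) := by
    apply Function.LeftInverse.injective (g := l)
    intro x
    exact LinearMap.congr_fun hl x
  have hk : RingHom.ker (algebraMap A (ResidueField A)) = maximalIdeal A := IsLocalRing.ker_residue
  have hex := exact_kerCotangentToTensor_mapBaseChange k A (ResidueField A) hs
  have hsurj := mapBaseChange_surjective k A (ResidueField A) hs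
  obtain ⟨j, hj, hjx⟩ : ∃ j : CotangentSpace A →ₗ[A] ResidueField A ⊗[A] Ω[A⁄k],
      Function.Injective j ∧ Function.Exact j (mapBaseChange k A (ResidueField A)) := by
    have : ∀ J : Ideal A, RingHom.ker (algebraMap A (ResidueField A)) = J →
      ∃ j : J.Cotangent →ₗ[A] ResidueField A ⊗[A] Ω[A⁄k],
      Function.Injective j ∧ Function.Exact j (mapBaseChange k A (ResidueField A)) := by
      rintro _ rfl
      exact ⟨_, hinj, hex⟩
    exact this _ hk
  let j' := LinearMap.extendScalarsOfSurjective hs j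
  have hj' : Function.Injective j' := hj
  have h1 := LinearMap.finrank_range_add_finrank_ker (mapBaseChange k A (ResidueField A))
  have h2 : LinearMap.ker (mapBaseChange k A (ResidueField A)) = LinearMap.range j' := by
    ext x; exact hjx x
  rw [LinearMap.range_eq_top.2 hsurj, finrank_top, h2, LinearMap.finrank_range_of_inj hj'] at h1
  rw [← h1, add_comm]

theorem aux_desc {k : Type*} [Field k] {R : Type*} [CommRing R] [Algebra k R] (I : Ideal R)
    (L : Type*) [Field L] [Algebra k L] [Algebra R L] [Algebra (R ⧸ I) L] [IsScalarTower k R L]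
    [IsScalarTower R (R ⧸ I) L] [IsScalarTower k (R ⧸ I) L]
    (d : Derivation k R L) (hd : ∀ x ∈ I, d x = 0) :
    ∃ d' : Derivation k (R ⧸ I) L, ∀ x, d' (Ideal.Quotient.mk I x) = d x := by
  have hsurj := Ideal.Quotient.mk_surjective (I := I)
  let g := Function.surjInv hsurj
  have hg : ∀ x, Ideal.Quotient.mk I (g x) = x := Function.surjInv_eq hsurj
  have key : ∀ x y, Ideal.Quotient.mk I x = Ideal.Quotient.mk I y → d x = d y := by
    intro x y h
    rw [← sub_eq_zero, ← map_sub]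
    exact hd _ (Ideal.Quotient.eq.1 h)
  have hsm : ∀ (x : R) (y : L), Ideal.Quotient.mk I x • y = x • y := fun x y =>
    algebraMap_smul (R ⧸ I) x y
  refine ⟨Derivation.mk' { toFun := fun x => d (g x), map_add' := ?_, map_smul' := ?_ } ?_, ?_⟩
  · intro x y
    rw [← map_add]
    apply key
    simp [hg]
  · intro c x
    rw [RingHom.id_apply, ← Derivation.map_smul]
    apply key
    rw [hg]
    change _ = Ideal.Quotient.mkₐ k I (c • g x)
    rw [map_smul]
    change _ = c • Ideal.Quotient.mk I (g x)
    rw [hg]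
  · intro a b
    change d (g (a * b)) = a • d (g b) + b • d (g a)
    rw [key (g (a * b)) (g a * g b) (by simp [hg]), Derivation.leibniz, ← hsm, ← hsm, hg, hg]
  · intro x
    exact key _ _ (hg _)

theorem aux_der_eq {k : Type*} [Field k] {n : ℕ} (L : Type*) [Field L] [Algebra k L]
    [Algebra (MvPolynomial (Fin n) k) L] [IsScalarTower k (MvPolynomial (Fin n) k) L]
    (d : Derivation k (MvPolynomial (Fin n) k) L) (p : MvPolynomial (Fin n) k) :
    d p = ∑ j, algebraMap (MvPolynomial (Fin n) k) L (MvPolynomial.pderiv j p)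
      * d (MvPolynomial.X j) := by
  have := (mvPolynomialBasis k (Fin n)).sum_repr (D k _ p)
  have h2 := congrArg d.liftKaehlerDifferential this
  rw [map_sum] at h2
  simp only [map_smul, mvPolynomialBasis_repr_apply, mvPolynomialBasis_apply,
    Derivation.liftKaehlerDifferential_comp_D] at h2
  rw [← h2]
  simp [Algebra.smul_def]

theorem aux_F {k : Type*} [Field k] {n s : ℕ} (f : Fin s → MvPolynomial (Fin n) k)
    (I : Ideal (MvPolynomial (Fin n) k)) (hI : I = Ideal.span (Set.range f))
    (L : Type*) [Field L] [Algebra k L] [Algebra (MvPolynomial (Fin n) k) L]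
    [Algebra (MvPolynomial (Fin n) k ⧸ I) L] [IsScalarTower k (MvPolynomial (Fin n) k) L]
    [IsScalarTower (MvPolynomial (Fin n) k) (MvPolynomial (Fin n) k ⧸ I) L]
    [IsScalarTower k (MvPolynomial (Fin n) k ⧸ I) L] :
    Module.finrank L (L ⊗[MvPolynomial (Fin n) k ⧸ I] Ω[MvPolynomial (Fin n) k ⧸ I⁄k]) +
      Matrix.rank (Matrix.of fun (i : Fin s) (j : Fin n) =>
        (algebraMap (MvPolynomial (Fin n) k ⧸ I) L)
          (Ideal.Quotient.mk I (MvPolynomial.pderiv j (f i)))) = n := by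
  set J := (Matrix.of fun (i : Fin s) (j : Fin n) =>
        (algebraMap (MvPolynomial (Fin n) k ⧸ I) L)
          (Ideal.Quotient.mk I (MvPolynomial.pderiv j (f i)))) with hJ
  have hJij : ∀ i j, J i j = algebraMap (MvPolynomial (Fin n) k) L
      (MvPolynomial.pderiv j (f i)) := by
    intro i j
    exact (IsScalarTower.algebraMap_apply (MvPolynomial (Fin n) k)
      (MvPolynomial (Fin n) k ⧸ I) L _).symm
  let S := MvPolynomial (Fin n) k ⧸ I
  let mk : MvPolynomial (Fin n) k →+* S := Ideal.Quotient.mk I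
  let Φ : Module.Dual L (L ⊗[S] Ω[S⁄k]) →ₗ[L] (Fin n → L) :=
    { toFun := fun φ j => φ (1 ⊗ₜ D k S (mk (MvPolynomial.X j)))
      map_add' := fun _ _ => rfl
      map_smul' := fun _ _ => rfl }
  have hder : ∀ φ : Module.Dual L (L ⊗[S] Ω[S⁄k]), ∃ d : Derivation k (MvPolynomial (Fin n) k) L,
      ∀ x, d x = φ (1 ⊗ₜ D k S (mk x)) := by
    intro φ
    let ψ : Ω[S⁄k] →ₗ[S] L := φ.restrictScalars S ∘ₗ TensorProduct.mk S L Ω[S⁄k] 1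
    let d₀ : Derivation k S L := ψ.compDer (D k S)
    have hd₀ : ∀ x, d₀ x = φ (1 ⊗ₜ D k S x) := fun _ => rfl
    refine ⟨Derivation.mk' { toFun := fun x => d₀ (mk x), map_add' := ?_, map_smul' := ?_ } ?_, ?_⟩
    · intro x y
      rw [map_add, map_add]
    · intro c x
      have : mk (c • x) = c • mk x := map_smul (Ideal.Quotient.mkₐ k I) c x
      rw [this, Derivation.map_smul, RingHom.id_apply]
    · intro a b
      change d₀ (mk (a * b)) = a • d₀ (mk b) + b • d₀ (mk a)
      rw [map_mul, Derivation.leibniz]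
      congr 1 <;> exact algebraMap_smul S _ _
    · intro x; rfl
  have hmk : Function.Surjective mk := Ideal.Quotient.mk_surjective
  have hinj : Function.Injective Φ := by
    rw [injective_iff_map_eq_zero]
    intro φ hφ
    obtain ⟨d, hd⟩ := hder φ
    have h0 : ∀ x, φ (1 ⊗ₜ D k S x) = 0 := by
      intro x
      obtain ⟨x, rfl⟩ := hmk x
      rw [← hd, aux_der_eq]
      refine Finset.sum_eq_zero fun j _ => ?_
      rw [hd]
      have : φ (1 ⊗ₜ D k S (mk (MvPolynomial.X j))) = 0 := congrFun hφ j
      rw [this, mul_zero]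
    apply LinearMap.ext
    intro t
    induction t with
    | zero => simp
    | add x y hx hy => rw [map_add, hx, hy]; simp
    | tmul a y =>
      have hy : y ∈ Submodule.span S (Set.range (D k S)) := by
        rw [span_range_derivation]; trivial
      have ha : (a ⊗ₜ[S] y : L ⊗[S] Ω[S⁄k]) = a • (1 ⊗ₜ y) := by simp [smul_tmul']
      rw [ha, map_smul]
      have : φ (1 ⊗ₜ y) = 0 := by
        let ψ : Ω[S⁄k] →ₗ[S] L := φ.restrictScalars S ∘ₗ TensorProduct.mk S L Ω[S⁄k] 1
        change ψ y = 0
        clear ha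
        induction hy using Submodule.span_induction with
        | mem x hx => obtain ⟨x, rfl⟩ := hx; exact h0 x
        | zero => simp
        | add x y _ _ hx hy => rw [map_add, hx, hy, add_zero]
        | smul c x _ hx => rw [map_smul, hx, smul_zero]
      rw [this]; simp
  have hrange : LinearMap.range Φ = LinearMap.ker J.mulVecLin := by
    ext v
    rw [LinearMap.mem_range, LinearMap.mem_ker]
    constructor
    · rintro ⟨φ, rfl⟩
      obtain ⟨d, hd⟩ := hder φ
      ext i
      have h1 := hd (f i)
      have h2 : mk (f i) = 0 := Ideal.Quotient.eq_zero_iff_mem.2 (by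
        rw [hI]; exact Ideal.subset_span ⟨i, rfl⟩)
      rw [h2, map_zero, tmul_zero, map_zero, aux_der_eq] at h1
      rw [Matrix.mulVecLin_apply, Matrix.mulVec, dotProduct]
      simp only [hJij]
      rw [Pi.zero_apply, ← h1]
      refine Finset.sum_congr rfl fun j _ => ?_
      rw [hd]; rfl
    · intro hv
      let d : Derivation k (MvPolynomial (Fin n) k) L := MvPolynomial.mkDerivation k v
      have hdf : ∀ i, d (f i) = 0 := by
        intro i
        rw [aux_der_eq]
        have := congrFun hv i
        rw [Matrix.mulVecLin_apply, Matrix.mulVec, dotProduct] at this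
        simp only [hJij] at this
        simpa [d] using this
      have hzero : ∀ x ∈ I, algebraMap (MvPolynomial (Fin n) k) L x = 0 := by
        intro x hx
        rw [IsScalarTower.algebraMap_apply _ S L]
        have : algebraMap (MvPolynomial (Fin n) k) S x = 0 := Ideal.Quotient.eq_zero_iff_mem.2 hx
        rw [this, map_zero]
      have hdI : ∀ x ∈ I, d x = 0 := by
        intro x hx
        rw [hI] at hx
        induction hx using Submodule.span_induction with
        | mem x hx => obtain ⟨i, rfl⟩ := hx; exact hdf i
        | zero => simp
        | add x y _ _ hx hy => rw [map_add, hx, hy, add_zero]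
        | smul c x hx' hx =>
          rw [smul_eq_mul, Derivation.leibniz, hx, smul_zero, zero_add, Algebra.smul_def, hzero,
            zero_mul]
          rw [hI]; exact hx'
      obtain ⟨d', hd'⟩ := aux_desc I L d hdI
      refine ⟨d'.liftKaehlerDifferential.liftBaseChange L, ?_⟩
      ext j
      change d'.liftKaehlerDifferential.liftBaseChange L (1 ⊗ₜ D k S (mk (MvPolynomial.X j))) = _
      rw [LinearMap.liftBaseChange_tmul, one_smul, Derivation.liftKaehlerDifferential_comp_D]
      exact (hd' _).trans (by simp [d])
  have h1 := LinearMap.finrank_range_add_finrank_ker J.mulVecLin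
  rw [← hrange, LinearMap.finrank_range_of_inj hinj, Subspace.dual_finrank_eq] at h1
  rw [Module.finrank_fin_fun] at h1
  rw [add_comm]
  exact h1

theorem aux_tower (R S A : Type*) [CommRing R] [CommRing S] [CommRing A] [Algebra R S] [Algebra R A]
    [Algebra S A] [IsScalarTower R S A] [IsLocalRing A] : IsScalarTower R S (ResidueField A) := by
  apply IsScalarTower.of_algebraMap_eq
  intro x
  change residue A (algebraMap R A x) = residue A (algebraMap S A (algebraMap R S x))
  rw [← IsScalarTower.algebraMap_apply R S A]

theorem aux_loc (k S : Type*) [Field k] [CommRing S] [Algebra k S] (q : Ideal S) [q.IsPrime] :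
    Module.finrank (ResidueField (Localization.AtPrime q))
      (ResidueField (Localization.AtPrime q) ⊗[Localization.AtPrime q] Ω[Localization.AtPrime q⁄k])
    = Module.finrank (ResidueField (Localization.AtPrime q))
      (ResidueField (Localization.AtPrime q) ⊗[S] Ω[S⁄k]) := by
  have : Algebra.FormallyEtale S (Localization.AtPrime q) :=
    Algebra.FormallyEtale.of_isLocalization q.primeCompl
  let e1 := tensorKaehlerEquivOfFormallyEtale k S (Localization.AtPrime q)
  let e2 := AlgebraTensorModule.cancelBaseChange S (Localization.AtPrime q)
    (ResidueField (Localization.AtPrime q)) (ResidueField (Localization.AtPrime q)) Ω[S⁄k]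
  exact LinearEquiv.finrank_eq
    ((e1.symm.baseChange (Localization.AtPrime q) (ResidueField (Localization.AtPrime q)) _ _).trans e2)

theorem aux_field_omega (k K L : Type*) [Field k] [Field K] [Field L] [Algebra k K] [Algebra k L]
    (φ : K →ₐ[k] L) (h : Function.Surjective φ) :
    Module.finrank K Ω[K⁄k] = Module.finrank L Ω[L⁄k] := by
  algebraize [φ.toRingHom]
  have : IsScalarTower k K L := IsScalarTower.of_algebraMap_eq fun x => (φ.commutes x).symm
  have hb : Function.Bijective (algebraMap K L) := ⟨φ.toRingHom.injective, h⟩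
  have : Algebra.FormallyEtale K L :=
    Algebra.FormallyEtale.of_equiv (AlgEquiv.ofBijective (Algebra.ofId K L) hb)
  rw [← (tensorKaehlerEquivOfFormallyEtale k K L).finrank_eq, Module.finrank_baseChange]

theorem aux_res_omega (k A B : Type*) [Field k] [CommRing A] [CommRing B] [IsLocalRing A]
    [IsLocalRing B] [Algebra k A] [Algebra k B] (f : A →+* B) [IsLocalHom f]
    (hf : ∀ c, f (algebraMap k A c) = algebraMap k B c) (hs : Function.Surjective f) :
    Module.finrank (ResidueField A) Ω[ResidueField A⁄k] =
      Module.finrank (ResidueField B) Ω[ResidueField B⁄k] := by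
  let φ : ResidueField A →ₐ[k] ResidueField B :=
    { ResidueField.map f with
      commutes' := by
        intro c
        change ResidueField.map f (residue A (algebraMap k A c)) = residue B (algebraMap k B c)
        rw [ResidueField.map_residue, hf] }
  refine aux_field_omega k (ResidueField A) (ResidueField B) φ ?_
  intro y
  obtain ⟨y, rfl⟩ := residue_surjective y
  obtain ⟨x, rfl⟩ := hs y
  exact ⟨residue A x, ResidueField.map_residue f x⟩

theorem aux_reg (k : Type*) [Field k] (n : ℕ) (p : Ideal (MvPolynomial (Fin n) k)) [p.IsPrime] :
    (embDim (Localization.AtPrime p) : WithBot ℕ∞) = p.height := by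
  have : IsRegularLocalRing (Localization.AtPrime p) := inferInstance
  rw [embDim, (IsRegularLocalRing.iff_finrank_cotangentSpace _).1 this,
    IsLocalization.AtPrime.ringKrullDim_eq_height p]

theorem aux_B {k : Type*} [Field k] [PerfectField k]
    (n s : ℕ) (f : Fin s → MvPolynomial (Fin n) k)
    (I : Ideal (MvPolynomial (Fin n) k)) (hI : I = Ideal.span (Set.range f))
    (𝔮 : Ideal (MvPolynomial (Fin n) k ⧸ I)) [𝔮.IsPrime]
    (𝔭 : Ideal (MvPolynomial (Fin n) k)) (h𝔭 : 𝔭 = Ideal.comap (Ideal.Quotient.mk I) 𝔮)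
    [𝔭.IsPrime] :
    embDim (Localization.AtPrime 𝔮) +
      (Matrix.rank (Matrix.of fun (i : Fin s) (j : Fin n) =>
        (algebraMap (MvPolynomial (Fin n) k ⧸ I)
            (ResidueField (Localization.AtPrime 𝔮)))
          (Ideal.Quotient.mk I (MvPolynomial.pderiv j (f i))))) =
    embDim (Localization.AtPrime 𝔭) := by
  have := aux_tower (MvPolynomial (Fin n) k) (MvPolynomial (Fin n) k ⧸ I) (Localization.AtPrime 𝔮)
  have := aux_tower k (MvPolynomial (Fin n) k ⧸ I) (Localization.AtPrime 𝔮)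
  have := aux_tower k (MvPolynomial (Fin n) k) (Localization.AtPrime 𝔮)
  have hF := aux_F f I hI (ResidueField (Localization.AtPrime 𝔮))
  have : Algebra.EssFiniteType (MvPolynomial (Fin n) k) (Localization.AtPrime 𝔭) :=
    Algebra.EssFiniteType.of_isLocalization _ 𝔭.primeCompl
  have : Algebra.EssFiniteType (MvPolynomial (Fin n) k ⧸ I) (Localization.AtPrime 𝔮) :=
    Algebra.EssFiniteType.of_isLocalization _ 𝔮.primeCompl
  have : Algebra.EssFiniteType k (Localization.AtPrime 𝔭) :=
    Algebra.EssFiniteType.comp k (MvPolynomial (Fin n) k) _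
  have : Algebra.EssFiniteType k (Localization.AtPrime 𝔮) :=
    Algebra.EssFiniteType.comp k (MvPolynomial (Fin n) k ⧸ I) _
  have : IsNoetherianRing (Localization.AtPrime 𝔮) :=
    IsLocalization.isNoetherianRing 𝔮.primeCompl _ inferInstance
  have : IsNoetherianRing (Localization.AtPrime 𝔭) :=
    IsLocalization.isNoetherianRing 𝔭.primeCompl _ inferInstance
  have hEq := aux_E k (Localization.AtPrime 𝔮)
  have hEp := aux_E k (Localization.AtPrime 𝔭)
  rw [aux_loc] at hEq hEp
  have hR : Module.finrank (ResidueField (Localization.AtPrime 𝔭))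
      (ResidueField (Localization.AtPrime 𝔭) ⊗[MvPolynomial (Fin n) k] Ω[MvPolynomial (Fin n) k⁄k])
      = n := by
    rw [Module.finrank_eq_card_basis
      ((mvPolynomialBasis k (Fin n)).baseChange (ResidueField (Localization.AtPrime 𝔭)))]
    simp
  let φ₀ : Localization.AtPrime 𝔭 →+* Localization.AtPrime 𝔮 :=
    Localization.localRingHom 𝔭 𝔮 (Ideal.Quotient.mk I) h𝔭
  have hl : IsLocalHom φ₀ := Localization.isLocalHom_localRingHom _ _ _ _
  have hφ₀ : Function.Surjective φ₀ := by
    subst h𝔭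
    exact RingHom.surjective_localRingHom_of_surjective _ Ideal.Quotient.mk_surjective _
  have hΩ := aux_res_omega k (Localization.AtPrime 𝔭) (Localization.AtPrime 𝔮) φ₀ (by
    intro c
    rw [IsScalarTower.algebraMap_apply k (MvPolynomial (Fin n) k) (Localization.AtPrime 𝔭),
      IsScalarTower.algebraMap_apply k (MvPolynomial (Fin n) k ⧸ I) (Localization.AtPrime 𝔮),
      Localization.localRingHom_to_map]
    rfl) hφ₀
  rw [hR] at hEp
  rw [embDim, embDim]
  omega

end

/-- Let `k` be a perfect field, `R = k[x₁,…,xₙ]`, `I = (f₁,…,f_s)`, `S = R/I`, `𝔮` a prime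
of `S` with residue field `L` and preimage `𝔭 ⊆ R`, and `Df(𝔮)` the Jacobian matrix
`(∂fᵢ/∂xⱼ)` evaluated in `L` at `𝔮`. Then
`ecodim(S_𝔮) = height(I·R_𝔭) − rank_L Df(𝔮)`, where `ecodim(S_𝔮) = edim(S_𝔮) − dim(S_𝔮)`;
equivalently `edim(S_𝔮) + rank_L Df(𝔮) = height(I·R_𝔭) + dim(S_𝔮)`. -/
theorem ecodim_eq_height_sub_jacobian_rank {k : Type*} [Field k] [PerfectField k]
    (n s : ℕ) (f : Fin s → MvPolynomial (Fin n) k)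
    (I : Ideal (MvPolynomial (Fin n) k)) (hI : I = Ideal.span (Set.range f))
    (𝔮 : Ideal (MvPolynomial (Fin n) k ⧸ I)) [𝔮.IsPrime]
    (𝔭 : Ideal (MvPolynomial (Fin n) k)) (h𝔭 : 𝔭 = Ideal.comap (Ideal.Quotient.mk I) 𝔮)
    [𝔭.IsPrime] :
    (embDim (Localization.AtPrime 𝔮) : WithBot ℕ∞) +
      (Matrix.rank (Matrix.of fun (i : Fin s) (j : Fin n) =>
        (algebraMap (MvPolynomial (Fin n) k ⧸ I)
            (ResidueField (Localization.AtPrime 𝔮)))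
          (Ideal.Quotient.mk I (MvPolynomial.pderiv j (f i)))) : WithBot ℕ∞) =
    (idealHeight (I.map (algebraMap (MvPolynomial (Fin n) k)
        (Localization.AtPrime 𝔭))) : WithBot ℕ∞) +
      Order.krullDim (PrimeSpectrum (Localization.AtPrime 𝔮)) := by
  rw [← Nat.cast_add, aux_B n s f I hI 𝔮 𝔭 h𝔭, aux_reg, ← aux_height_sum k n I 𝔮 𝔭 h𝔭]
  have h := IsLocalization.AtPrime.ringKrullDim_eq_height 𝔮 (Localization.AtPrime 𝔮)
  rw [ringKrullDim] at h
  rw [h]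
  rfl
end

section
/- Let X be a scheme of finite type over a perfect field k and let X' ⊂ X be an irreducible closed subset. Then there exists a nonempty open subset U' of X' such that the function x ↦ ecodim(𝒪_{X,x}) is constant on U'. -/
open IsLocalRing AlgebraicGeometry CategoryTheory

lemma height_generic {S : Type*} [CommRing S] [IsNoetherianRing S] (P : Ideal S) [P.IsPrime] :
    ∃ g : S, g ∉ P ∧ ∀ (Q : Ideal S) [Q.IsPrime], P ≤ Q → g ∉ Q →
      Q.height = P.height + (Q.map (Ideal.Quotient.mk P)).height := by
  classical
  obtain ⟨s, hs, hcard⟩ := P.exists_finset_card_eq_height_of_isNoetherianRing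
  have hfin : (Ideal.span (s : Set S)).minimalPrimes.Finite :=
    Ideal.finite_minimalPrimes_of_isNoetherianRing S _
  obtain ⟨g, hgP, hg⟩ : ∃ g : S, g ∉ P ∧ ∀ p ∈ (Ideal.span (s : Set S)).minimalPrimes, p ≠ P →
      g ∈ p := by
    have h : ¬ (hfin.toFinset.erase P).inf id ≤ P := by
      intro h
      obtain ⟨p, hp, hpP⟩ := (Ideal.IsPrime.inf_le' ‹P.IsPrime›).mp h
      simp only [Finset.mem_erase, Set.Finite.mem_toFinset] at hp
      exact hp.1 (le_antisymm hpP (hs.2 hp.2.1 hpP))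
    obtain ⟨g, hg, hgP⟩ := SetLike.not_le_iff_exists.mp h
    refine ⟨g, hgP, fun p hp hne => ?_⟩
    have : (hfin.toFinset.erase P).inf id ≤ p := 
      Finset.inf_le (f := id) (by simp [hp, hne])
    exact this hg
  refine ⟨g, hgP, fun Q _ hPQ hgQ => ?_⟩
  have hprime : (Q.map (Ideal.Quotient.mk P)).IsPrime :=
    Ideal.isPrime_map_quotientMk_of_isPrime hPQ
  have hcomap : (Q.map (Ideal.Quotient.mk P)).comap (Ideal.Quotient.mk P) = Q := by
    rw [Ideal.comap_map_of_surjective _ Ideal.Quotient.mk_surjective, ← RingHom.ker_eq_comap_bot,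
      Ideal.mk_ker, sup_eq_left.mpr hPQ]
  refine le_antisymm ?_ ?_
  · obtain ⟨t', ht', hcard'⟩ :=
      (Q.map (Ideal.Quotient.mk P)).exists_finset_card_eq_height_of_isNoetherianRing
    let t : Finset S := t'.image (fun x => (Ideal.Quotient.mk_surjective x).choose)
    have htt : ∀ x ∈ t', ∃ y ∈ t, Ideal.Quotient.mk P y = x := fun x hx =>
      ⟨_, Finset.mem_image_of_mem _ hx, (Ideal.Quotient.mk_surjective x).choose_spec⟩
    have htt2 : ∀ y ∈ t, Ideal.Quotient.mk P y ∈ t' := by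
      intro y hy
      obtain ⟨x, hx, rfl⟩ := Finset.mem_image.mp hy
      rwa [(Ideal.Quotient.mk_surjective x).choose_spec]
    have hmin : Q ∈ (Ideal.span ((s ∪ t : Finset S) : Set S)).minimalPrimes := by
      refine ⟨⟨inferInstance, ?_⟩, ?_⟩
      · rw [Ideal.span_le]
        intro y hy
        rcases Finset.mem_union.mp (Finset.mem_coe.mp hy) with hy | hy
        · exact hPQ (hs.1.2 (Ideal.subset_span hy))
        · rw [← hcomap]
          exact ht'.1.2 (Ideal.subset_span (htt2 y hy))
      · rintro Q' ⟨hQ', hle⟩ hQ'Q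
        have h1 : Ideal.span (s : Set S) ≤ Q' :=
          (Ideal.span_mono (by simp)).trans hle
        obtain ⟨p, hp, hpQ'⟩ := Ideal.exists_minimalPrimes_le h1
        have hpP : p = P := by
          by_contra hne
          exact hgQ (hQ'Q (hpQ' (hg p hp hne)))
        subst hpP
        have h2 : (Q'.map (Ideal.Quotient.mk p)).IsPrime :=
          Ideal.isPrime_map_quotientMk_of_isPrime hpQ'
        have h3 : Ideal.span (t' : Set (S ⧸ p)) ≤ Q'.map (Ideal.Quotient.mk p) := by
          rw [Ideal.span_le]
          intro x hx
          obtain ⟨y, hy, rfl⟩ := htt x hx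
          exact Ideal.mem_map_of_mem _ (hle (Ideal.subset_span (by simp [hy])))
        have h4 := ht'.2 ⟨h2, h3⟩ (Ideal.map_mono hQ'Q)
        have h5 : (Q'.map (Ideal.Quotient.mk p)).comap (Ideal.Quotient.mk p) = Q' := by
          rw [Ideal.comap_map_of_surjective _ Ideal.Quotient.mk_surjective,
            ← RingHom.ker_eq_comap_bot, Ideal.mk_ker, sup_eq_left.mpr hpQ']
        rw [← hcomap, ← h5]
        exact Ideal.comap_mono h4
    refine (Ideal.height_le_card_of_mem_minimalPrimes_span_finset hmin).trans ?_
    rw [← hcard, ← hcard']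
    norm_cast
    exact (Finset.card_union_le _ _).trans (by gcongr; exact Finset.card_image_le)
  · obtain ⟨lq, hlq, hlenq⟩ :=
      (Q.map (Ideal.Quotient.mk P)).exists_ltSeries_length_eq_height
    let l' : LTSeries (PrimeSpectrum S) :=
      lq.map (PrimeSpectrum.comap (Ideal.Quotient.mk P))
        (RingHom.strictMono_comap_of_surjective Ideal.Quotient.mk_surjective)
    have hP : P ≤ l'.head.asIdeal := by
      intro x hx
      simp only [LTSeries.head_map, l', PrimeSpectrum.comap_asIdeal, Ideal.mem_comap]
      rw [Ideal.Quotient.eq_zero_iff_mem.mpr hx]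
      exact zero_mem _
    obtain ⟨lp, hlp, hlenp⟩ := l'.head.asIdeal.exists_ltSeries_length_eq_height
    have hlp' : lp.last = l'.head := hlp
    have hlen : (lp.smash l' hlp').length = lp.length + lq.length := by simp [l']
    refine (add_le_add_left (Ideal.height_mono hP) _).trans ?_
    rw [← hlenp, ← hlenq, ← Nat.cast_add, ← hlen,
      (⟨Q, ‹_›⟩ : PrimeSpectrum S).height_eq_orderHeight]
    apply Order.length_le_height
    simp [hlq, l', ← PrimeSpectrum.asIdeal_le_asIdeal, hcomap]

lemma isRegularRing_of_etale (R T : Type*) [CommRing R] [CommRing T] [Algebra R T]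
    [Algebra.Etale R T] [IsRegularRing R] : IsRegularRing T := by
  have : IsNoetherianRing T := Algebra.FiniteType.isNoetherianRing R T
  rw [isRegularRing_iff]
  intro q _
  let p := q.under R
  have : Algebra.HasGoingDown R T := inferInstance
  let := Localization.AtPrime.algebraOfLiesOver p q
  apply IsRegularLocalRing.of_spanFinrank_maximalIdeal_le
  have h1 := ((Algebra.isUnramifiedAt_iff_map_eq R p q).mp inferInstance).2
  have h2 : (maximalIdeal (Localization.AtPrime p)).map
      (algebraMap (Localization.AtPrime p) (Localization.AtPrime q)) = maximalIdeal _ := by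
    rw [← Localization.AtPrime.map_eq_maximalIdeal, Ideal.map_map,
      ← IsScalarTower.algebraMap_eq, h1]
  have h3 := (isRegularLocalRing_iff (Localization.AtPrime p)).mp inferInstance
  rw [IsLocalization.AtPrime.ringKrullDim_eq_height p] at h3
  rw [IsLocalization.AtPrime.ringKrullDim_eq_height q,
    Ideal.height_eq_height_add_of_liesOver_of_hasGoingDown p q, ← h2]
  refine le_trans (Nat.cast_le.mpr (Ideal.spanFinrank_map_le_of_fg _
    (IsNoetherian.noetherian _))) ?_
  rw [h3]
  exact WithBot.coe_le_coe.mpr le_self_add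

open TensorProduct in
/-- Generic constancy of fibre dimension. -/
lemma generic_rank {D N : Type*} [CommRing D] [IsDomain D] [IsNoetherianRing D]
    [AddCommGroup N] [Module D N] [Module.Finite D N] :
    ∃ f : D, f ≠ 0 ∧ ∃ r : ℕ, ∀ (K : Type) [Field K] [Algebra D K], algebraMap D K f ≠ 0 →
      Module.finrank K (K ⊗[D] N) = r := by
  have : Module.FinitePresentation D N := Module.finitePresentation_of_finite D N
  obtain ⟨f, hf, h1, h2⟩ := Module.FinitePresentation.exists_free_localizedModule_powers
    (nonZeroDivisors D) (LocalizedModule.mkLinearMap (nonZeroDivisors D) N) (FractionRing D)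
  refine ⟨f, nonZeroDivisors.ne_zero hf, Module.finrank (Localization.Away f) (LocalizedModule.Away f N), fun K _ _ hK => ?_⟩
  let φ : Localization.Away f →+* K := IsLocalization.Away.lift f (isUnit_iff_ne_zero.mpr hK)
  let := φ.toAlgebra
  have : IsScalarTower D (Localization.Away f) K := .of_algebraMap_eq' 
    (IsLocalization.Away.lift_comp f (isUnit_iff_ne_zero.mpr hK)).symm
  have hb : IsBaseChange (Localization.Away f)
    (LocalizedModule.mkLinearMap (Submonoid.powers f) N) := IsLocalizedModule.isBaseChange (Submonoid.powers f) _ _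
  have e1 := TensorProduct.AlgebraTensorModule.cancelBaseChange D (Localization.Away f) K K N
  have e2 := hb.equiv
  have e3 : K ⊗[Localization.Away f] ((Localization.Away f) ⊗[D] N) ≃ₗ[K]
     K ⊗[Localization.Away f] (LocalizedModule.Away f N) := 
     TensorProduct.AlgebraTensorModule.congr (.refl _ _) hb.equiv
  have := φ.domain_nontrivial
  rw [← e1.finrank_eq, e3.finrank_eq]
  rw [Module.finrank_baseChange]

lemma isNilpotent_ker_kerSquareLift {R A B : Type*} [CommRing R] [CommRing A] [CommRing B]
    [Algebra R A] [Algebra R B] (f : A →ₐ[R] B) :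
    IsNilpotent (RingHom.ker (f.kerSquareLift : A ⧸ RingHom.ker f.toRingHom ^ 2 →+* B)) := by
  refine ⟨2, ?_⟩
  have h : RingHom.ker (f.kerSquareLift : A ⧸ RingHom.ker f.toRingHom ^ 2 →+* B) = (RingHom.ker f.toRingHom).cotangentIdeal :=
    AlgHom.ker_kerSquareLift f
  rw [h]
  exact Ideal.cotangentIdeal_square _

open TensorProduct KaehlerDifferential in
lemma edim_formula (k A : Type*) [Field k] [CommRing A] [IsLocalRing A] [IsNoetherianRing A] [Algebra k A]
    [Algebra.FormallySmooth k (ResidueField A)] [Algebra.EssFiniteType k A] :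
    Module.finrank (ResidueField A) (CotangentSpace A) +
      Module.finrank (ResidueField A) (Ω[ResidueField A⁄k]) =
      Module.finrank (ResidueField A) (ResidueField A ⊗[A] Ω[A⁄k]) := by
  have hsurj : Function.Surjective (algebraMap A (ResidueField A)) := Ideal.Quotient.mk_surjective
  have hex := exact_kerCotangentToTensor_mapBaseChange k A (ResidueField A) hsurj
  have hinj : Function.Injective (kerCotangentToTensor k A (ResidueField A)) := by
    have h1 : Function.Surjective
        (IsScalarTower.toAlgHom k A (ResidueField A)).kerSquareLift := by
      intro x
      obtain ⟨y, rfl⟩ := hsurj x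
      exact ⟨Ideal.Quotient.mk _ y, rfl⟩
    have h2 := isNilpotent_ker_kerSquareLift (IsScalarTower.toAlgHom k A (ResidueField A))
    let l := (retractionKerCotangentToTensorEquivSection (R := k) hsurj).symm
      ⟨_, Algebra.FormallySmooth.comp_liftOfSurjective (AlgHom.id k (ResidueField A)) _ h1 h2⟩
    exact Function.LeftInverse.injective (g := l.1) (fun x => LinearMap.congr_fun l.2 x)
  have hs := KaehlerDifferential.mapBaseChange_surjective k A (ResidueField A) hsurj
  have hker : RingHom.ker (algebraMap A (ResidueField A)) = maximalIdeal A := IsLocalRing.ker_residue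
  have aux : ∀ I J : Ideal A, I = J → Nonempty (I.Cotangent ≃ₗ[A] J.Cotangent) := by
    rintro I _ rfl
    exact ⟨.refl _ _⟩
  obtain ⟨e1⟩ := aux _ _ hker
  have e2 := LinearEquiv.ofInjective _ hinj
  have e3 := LinearEquiv.ofEq _ _
    (KaehlerDifferential.range_kerCotangentToTensor k A (ResidueField A) hsurj)
  have e4 : CotangentSpace A ≃ₗ[A] LinearMap.ker (mapBaseChange k A (ResidueField A)) :=
    (e1.symm.trans e2).trans e3
  have e5 := e4.extendScalarsOfSurjective hsurj
  have h := (mapBaseChange k A (ResidueField A)).finrank_range_add_finrank_ker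
  rw [LinearMap.range_eq_top.mpr hs, finrank_top, ← e5.finrank_eq] at h
  omega

open TensorProduct KaehlerDifferential in
lemma edim_formula' (k S : Type*) [Field k] [PerfectField k] [CommRing S] [Algebra k S]
    [Algebra.FiniteType k S] (Q : Ideal S) [Q.IsPrime] :
    Module.finrank Q.ResidueField (CotangentSpace (Localization.AtPrime Q)) +
      Module.finrank Q.ResidueField (Ω[Q.ResidueField⁄k]) =
      Module.finrank Q.ResidueField (Q.ResidueField ⊗[S] Ω[S⁄k]) := by
  have : IsNoetherianRing S := Algebra.FiniteType.isNoetherianRing k S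
  have : IsNoetherianRing (Localization.AtPrime Q) :=
    IsLocalization.isNoetherianRing Q.primeCompl _ inferInstance
  have : Algebra.EssFiniteType S (Localization.AtPrime Q) :=
    .of_isLocalization _ Q.primeCompl
  have : Algebra.EssFiniteType k (Localization.AtPrime Q) := .comp k S _
  have : Algebra.EssFiniteType k Q.ResidueField := .comp k (Localization.AtPrime Q) _
  have h := edim_formula k (Localization.AtPrime Q)
  refine h.trans ?_
  have : Algebra.FormallyEtale S (Localization.AtPrime Q) :=
    Algebra.FormallyEtale.of_isLocalization Q.primeCompl
  have e1 := TensorProduct.AlgebraTensorModule.cancelBaseChange S (Localization.AtPrime Q)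
    Q.ResidueField Q.ResidueField Ω[S⁄k]
  have e2 : Q.ResidueField ⊗[Localization.AtPrime Q] (Localization.AtPrime Q ⊗[S] Ω[S⁄k])
      ≃ₗ[Q.ResidueField] _ :=
    TensorProduct.AlgebraTensorModule.congr (.refl _ _)
    (tensorKaehlerEquivOfFormallyEtale k S (Localization.AtPrime Q))
  exact (e1.symm.trans e2).symm.finrank_eq

/-- Generic regularity. -/
lemma generic_regular (k D : Type) [Field k] [PerfectField k] [CommRing D] [IsDomain D]
    [Algebra k D] [Algebra.FiniteType k D] :
    ∃ f : D, f ≠ 0 ∧ ∀ (q : Ideal D) [q.IsPrime], f ∉ q →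
      IsRegularLocalRing (Localization.AtPrime q) := by
  have : Algebra.FinitePresentation k D := Algebra.FinitePresentation.of_finiteType.mp inferInstance
  have hsm : Algebra.IsSmoothAt k (⊥ : Ideal D) := by
    let : Field (Localization.AtPrime (⊥ : Ideal D)) := IsField.toField <| by
      rw [isField_iff_maximalIdeal_eq, ← Localization.AtPrime.map_eq_maximalIdeal, Ideal.map_bot]
    have : Algebra.EssFiniteType D (Localization.AtPrime (⊥ : Ideal D)) :=
      .of_isLocalization _ (⊥ : Ideal D).primeCompl
    have : Algebra.EssFiniteType k (Localization.AtPrime (⊥ : Ideal D)) := .comp k D _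
    exact Algebra.FormallySmooth.of_perfectField
  obtain ⟨f, hf, hstd⟩ := Algebra.IsSmoothAt.exists_notMem_isStandardSmooth k (⊥ : Ideal D)
  have hreg : IsRegularRing (Localization.Away f) := by
    have : (algebraMap k (Localization.Away f)).IsStandardSmooth :=
      RingHom.isStandardSmooth_algebraMap.mpr hstd
    obtain ⟨n, g, -, hg⟩ := this.exists_etale_mvPolynomial
    algebraize [g]
    exact isRegularRing_of_etale (MvPolynomial (Fin n) k) _
  refine ⟨f, by simpa using hf, fun q _ hq => ?_⟩
  have hdisj : Disjoint (Submonoid.powers f : Set D) (q : Set D) :=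
    (Ideal.disjoint_powers_iff_notMem f (Ideal.IsPrime.isRadical ‹_›)).mpr hq
  let q' := q.map (algebraMap D (Localization.Away f))
  have hq' : q'.IsPrime := IsLocalization.isPrime_of_isPrime_disjoint (.powers f) _ q ‹_› hdisj
  have hc : q'.comap (algebraMap D (Localization.Away f)) = q :=
    IsLocalization.under_map_of_isPrime_disjoint (.powers f) _ ‹_› hdisj
  have hloc : IsLocalization.AtPrime (Localization.AtPrime q') (q'.comap (algebraMap D (Localization.Away f))) :=
    IsLocalization.isLocalization_isLocalization_atPrime_isLocalization (.powers f) _ q'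
  have hloc' : IsLocalization.AtPrime (Localization.AtPrime q') q := by
    convert hloc
    exact hc.symm
  exact IsRegularLocalRing.of_ringEquiv
    (IsLocalization.algEquiv q.primeCompl (Localization.AtPrime q')
      (Localization.AtPrime q)).toRingEquiv

open TensorProduct KaehlerDifferential in
lemma omega_eq (k S : Type) [Field k] [CommRing S] [Algebra k S]
    (P Q : Ideal S) [Q.IsPrime] (q : Ideal (S ⧸ P)) [q.IsPrime]
    (hq : Q = q.comap (Ideal.Quotient.mk P)) :
    Module.finrank Q.ResidueField (Ω[Q.ResidueField⁄k]) =
    Module.finrank q.ResidueField (Ω[q.ResidueField⁄k]) := by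
  have hb := (RingHom.surjectiveOnStalks_of_surjective
    (Ideal.Quotient.mk_surjective (I := P))).residueFieldMap_bijective Q q hq
  let φ := Ideal.ResidueField.map Q q (Ideal.Quotient.mk P) hq
  let := φ.toAlgebra
  have : IsScalarTower k Q.ResidueField q.ResidueField := by
    refine .of_algebraMap_eq fun x => ?_
    rw [IsScalarTower.algebraMap_apply k S Q.ResidueField,
      IsScalarTower.algebraMap_apply k (S ⧸ P) q.ResidueField]
    exact (Ideal.ResidueField.map_algebraMap Q q (Ideal.Quotient.mk P) hq _).symm
  let e : Q.ResidueField ≃ₐ[Q.ResidueField] q.ResidueField :=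
    AlgEquiv.ofBijective (Algebra.ofId _ _) hb
  have : Algebra.FormallyEtale Q.ResidueField q.ResidueField := .of_equiv e
  rw [← (tensorKaehlerEquivOfFormallyEtale k Q.ResidueField q.ResidueField).finrank_eq,
    Module.finrank_baseChange]

open TensorProduct KaehlerDifferential in
lemma alg_main (k S : Type) [Field k] [PerfectField k] [CommRing S] [Algebra k S]
    [Algebra.FiniteType k S] (P : Ideal S) [P.IsPrime] :
    ∃ g : S, g ∉ P ∧ ∃ c : ℕ, ∀ (Q : Ideal S) [Q.IsPrime], P ≤ Q → g ∉ Q →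
      ((Module.finrank Q.ResidueField (CotangentSpace (Localization.AtPrime Q)) : ℕ) :
        WithBot ℕ∞) = c + ringKrullDim (Localization.AtPrime Q) := by
  have : IsNoetherianRing S := Algebra.FiniteType.isNoetherianRing k S
  obtain ⟨g, hg, hht⟩ := height_generic P
  obtain ⟨f1, hf1, hreg⟩ := generic_regular k (S ⧸ P)
  obtain ⟨f2, hf2, rS, hrS⟩ := generic_rank (D := S ⧸ P) (N := (S ⧸ P) ⊗[S] Ω[S⁄k])
  obtain ⟨f3, hf3, rD, hrD⟩ := generic_rank (D := S ⧸ P) (N := Ω[(S ⧸ P)⁄k])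
  obtain ⟨s, hs⟩ := Ideal.Quotient.mk_surjective (f1 * f2 * f3)
  have hsP : s ∉ P := by
    rw [← Ideal.Quotient.eq_zero_iff_mem, hs]
    simp [hf1, hf2, hf3]
  have hPfin : P.height ≠ ⊤ := Ideal.height_ne_top Ideal.IsPrime.ne_top'
  obtain ⟨hP, hhP⟩ := ENat.ne_top_iff_exists.mp hPfin
  refine ⟨s * g, fun h => (Ideal.IsPrime.mem_or_mem ‹_› h).elim hsP hg, rS - rD - hP,
    fun Q _ hPQ hgQ => ?_⟩
  have hg' : g ∉ Q := fun h => hgQ (Q.mul_mem_left _ h)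
  have hs' : s ∉ Q := fun h => hgQ (Q.mul_mem_right _ h)
  have hprime : (Q.map (Ideal.Quotient.mk P)).IsPrime :=
    Ideal.isPrime_map_quotientMk_of_isPrime hPQ
  have hcomap : (Q.map (Ideal.Quotient.mk P)).comap (Ideal.Quotient.mk P) = Q := by
    rw [Ideal.comap_map_of_surjective _ Ideal.Quotient.mk_surjective, ← RingHom.ker_eq_comap_bot,
      Ideal.mk_ker, sup_eq_left.mpr hPQ]
  have h1 := hht Q hPQ hg'
  generalize hq : Q.map (Ideal.Quotient.mk P) = q at *
  have hsq : f1 * f2 * f3 ∉ q := by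
    rw [← hs, ← Ideal.mem_comap, hcomap]; exact hs'
  have hq1 : f1 ∉ q := fun h => hsq (q.mul_mem_right _ (q.mul_mem_right _ h))
  have hq2 : f2 ∉ q := fun h => hsq (q.mul_mem_right _ (q.mul_mem_left _ h))
  have hq3 : f3 ∉ q := fun h => hsq (q.mul_mem_left _ h)
  have hω := omega_eq k S P Q q hcomap.symm
  have hE1 := edim_formula' k S Q
  have hE2 := edim_formula' k (S ⧸ P) q
  have hR := hreg q hq1
  have hR2 := (IsRegularLocalRing.iff_finrank_cotangentSpace _).mp hR
  rw [IsLocalization.AtPrime.ringKrullDim_eq_height q] at hR2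
  rw [hrD q.ResidueField (by rwa [ne_eq, Ideal.algebraMap_residueField_eq_zero])] at hE2
  have hK : Module.finrank Q.ResidueField (Q.ResidueField ⊗[S] Ω[S⁄k]) = rS := by
    let φ : S ⧸ P →+* Q.ResidueField := Ideal.Quotient.lift P (algebraMap S Q.ResidueField)
      (fun a ha => Ideal.algebraMap_residueField_eq_zero.mpr (hPQ ha))
    let := φ.toAlgebra
    have : IsScalarTower S (S ⧸ P) Q.ResidueField := .of_algebraMap_eq' (by
      ext x; rfl)
    have hne : algebraMap (S ⧸ P) Q.ResidueField f2 ≠ 0 := by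
      obtain ⟨y, rfl⟩ := Ideal.Quotient.mk_surjective f2
      change algebraMap S Q.ResidueField y ≠ 0
      rw [ne_eq, Ideal.algebraMap_residueField_eq_zero, ← hcomap]
      exact hq2
    rw [← hrS Q.ResidueField hne]
    exact (TensorProduct.AlgebraTensorModule.cancelBaseChange S (S ⧸ P)
      Q.ResidueField Q.ResidueField Ω[S⁄k]).symm.finrank_eq
  rw [hK] at hE1
  have : IsNoetherianRing (Localization.AtPrime Q) :=
    IsLocalization.isNoetherianRing Q.primeCompl _ inferInstance
  have hle := ringKrullDim_le_spanFinrank_maximalIdeal (Localization.AtPrime Q)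
  rw [spanFinrank_maximalIdeal_eq_finrank_cotangentSpace,
    IsLocalization.AtPrime.ringKrullDim_eq_height Q] at hle
  rw [IsLocalization.AtPrime.ringKrullDim_eq_height Q]
  obtain ⟨hQ, hhQ⟩ := ENat.ne_top_iff_exists.mp (Ideal.height_ne_top (I := Q) Ideal.IsPrime.ne_top')
  obtain ⟨hq', hhq⟩ := ENat.ne_top_iff_exists.mp (Ideal.height_ne_top (I := q) Ideal.IsPrime.ne_top')
  rw [← hhQ, ← hhP, ← hhq] at h1
  rw [← hhQ] at hle ⊢
  rw [← hhq] at hR2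
  norm_cast at h1 hle hR2
  change Module.finrank q.ResidueField (CotangentSpace (Localization.AtPrime q)) = _ at hR2
  change _ ≤ Module.finrank Q.ResidueField (CotangentSpace (Localization.AtPrime Q)) at hle
  have key : Module.finrank Q.ResidueField (CotangentSpace (Localization.AtPrime Q)) =
      (rS - rD - hP) + hQ := by omega
  rw [key, Nat.cast_add]
  rfl

lemma alg_main' (k S : Type) [Field k] [PerfectField k] [CommRing S] [Algebra k S]
    [Algebra.FiniteType k S] (P : Ideal S) [P.IsPrime] :
    ∃ g : S, g ∉ P ∧ ∃ c : ℕ, ∀ (Q : Ideal S) [Q.IsPrime], P ≤ Q → g ∉ Q →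
      ∀ (A : Type) [CommRing A] [IsLocalRing A] [Algebra S A] [IsLocalization.AtPrime A Q],
      (embDim A : WithBot ℕ∞) = c + Order.krullDim (PrimeSpectrum A) := by
  have : IsNoetherianRing S := Algebra.FiniteType.isNoetherianRing k S
  obtain ⟨g, hg, c, h⟩ := alg_main k S P
  refine ⟨g, hg, c, fun Q _ hPQ hgQ A _ _ _ _ => ?_⟩
  have : IsNoetherianRing (Localization.AtPrime Q) :=
    IsLocalization.isNoetherianRing Q.primeCompl _ inferInstance
  have : IsNoetherianRing A :=
    IsLocalization.isNoetherianRing Q.primeCompl _ inferInstance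
  have h0 := h Q hPQ hgQ
  let e : Localization.AtPrime Q ≃+* A :=
    (IsLocalization.algEquiv Q.primeCompl (Localization.AtPrime Q) A).toRingEquiv
  change _ = _ + ringKrullDim A
  rw [← ringKrullDim_eq_of_ringEquiv e, ← h0, embDim,
    ← spanFinrank_maximalIdeal_eq_finrank_cotangentSpace]
  change _ = ((Module.finrank (ResidueField (Localization.AtPrime Q))
    (CotangentSpace (Localization.AtPrime Q)) : ℕ) : WithBot ℕ∞)
  rw [← spanFinrank_maximalIdeal_eq_finrank_cotangentSpace, ← map_ringEquiv_maximalIdeal e,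
    Ideal.spanFinrank_map_eq_of_ringEquiv]

/-- Let `X` be a scheme of finite type over a perfect field `k` and `X' ⊆ X` an
irreducible closed subset. Then there is a nonempty open subset `U'` of `X'` on which
the embedding codimension `x ↦ ecodim(𝒪_{X,x}) = edim(𝒪_{X,x}) − dim(𝒪_{X,x})` is
constant (the constancy with value `c` being expressed additively as
`edim(𝒪_{X,x}) = c + dim(𝒪_{X,x})`). -/
theorem exists_open_ecodim_constant {k : Type} [Field k] [PerfectField k]
    (X : Scheme) (f : X ⟶ Spec (CommRingCat.of k))
    [LocallyOfFiniteType f] [QuasiCompact f]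
    (Z : Set X) (hZc : IsClosed Z) (hZi : IsIrreducible Z) :
    ∃ U : Set X, IsOpen U ∧ (U ∩ Z).Nonempty ∧ ∃ c : ℕ,
      ∀ x ∈ U ∩ Z,
        (embDim (X.presheaf.stalk x) : WithBot ℕ∞) =
          (c : WithBot ℕ∞) + Order.krullDim (PrimeSpectrum (X.presheaf.stalk x)) := by
  have hz := hZi.isGenericPoint_genericPoint hZc
  generalize hZi.genericPoint = z at hz
  obtain ⟨_, ⟨U, hU, rfl⟩, hzU, -⟩ :=
    X.isBasis_affineOpens.exists_subset_of_mem_open (Set.mem_univ z) isOpen_univ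
  have hU : IsAffineOpen U := hU
  have hzU : z ∈ U := hzU
  have hft := Scheme.Hom.finiteType_appLE f (isAffineOpen_top (Spec (CommRingCat.of k))) hU le_top
  let ψ : k →+* Γ(X, U) := (f.appLE ⊤ U le_top).hom.comp
    (Scheme.ΓSpecIso (CommRingCat.of k)).inv.hom
  have hψ : ψ.FiniteType := hft.comp (RingHom.FiniteType.of_surjective _
    (ConcreteCategory.bijective_of_isIso (Scheme.ΓSpecIso (CommRingCat.of k)).inv).surjective)
  let := ψ.toAlgebra
  have : Algebra.FiniteType k Γ(X, U) := hψ
  obtain ⟨g, hg, c, h⟩ := alg_main' k Γ(X, U) (hU.primeIdealOf ⟨z, hzU⟩).asIdeal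
  have key : ∀ (s : Γ(X, U)) (x : X) (hx : x ∈ U),
      x ∈ X.basicOpen s ↔ s ∉ (hU.primeIdealOf ⟨x, hx⟩).asIdeal := by
    intro s x hx
    let := (X.presheaf.germ U x hx).hom.toAlgebra
    have : IsLocalization.AtPrime (X.presheaf.stalk x) (hU.primeIdealOf ⟨x, hx⟩).asIdeal :=
      hU.isLocalization_stalk ⟨x, hx⟩
    rw [Scheme.mem_basicOpen X s x hx]
    exact IsLocalization.AtPrime.isUnit_to_map_iff (X.presheaf.stalk x)
      (hU.primeIdealOf ⟨x, hx⟩).asIdeal s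
  refine ⟨X.basicOpen g, (X.basicOpen g).isOpen, ⟨z, (key g z hzU).mpr hg, hz.mem⟩, c, ?_⟩
  rintro x ⟨hxg, hxZ⟩
  have hxU : x ∈ U := X.basicOpen_le g hxg
  let := (X.presheaf.germ U x hxU).hom.toAlgebra
  have : IsLocalization.AtPrime (X.presheaf.stalk x) (hU.primeIdealOf ⟨x, hxU⟩).asIdeal :=
    hU.isLocalization_stalk ⟨x, hxU⟩
  refine h (hU.primeIdealOf ⟨x, hxU⟩).asIdeal ?_ ((key g x hxU).mp hxg) (X.presheaf.stalk x)
  intro s hs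
  by_contra hsx
  refine (key s z hzU).mp ?_ hs
  exact (hz.specializes hxZ).mem_open (X.basicOpen s).isOpen ((key s x hxU).mpr hsx)
end

section
/- Consider the affine scheme X = X₁ ∪ X₂ ⊂ 𝔸³ over ℂ, where X₁ = V(x) and X₂ = V((y,z)²) (a double line), i.e. X = Spec ℂ[x,y,z]/((x) ∩ (y,z)²). Let 0 denote the origin and η the generic point of X₂. Then ecodim(𝒪_{X,0}) = 1 while ecodim(𝒪_{X,η}) = 2; in particular the embedding codimension is not upper semi-continuous under generization on X. -/
open IsLocalRing MvPolynomial

/-- Embedding dimension of a localization from a minimal system of generators. -/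
lemma embDim_of_gens {A : Type*} [CommRing A] [IsNoetherianRing A] (p : Ideal A) [p.IsPrime]
    {ι : Type*} [Fintype ι] (x : ι → A) (hp : p = Ideal.span (Set.range x))
    (h : ∀ b : ι → A, ∑ i, b i * x i ∈ p ^ 2 → ∀ i, b i ∈ p) :
    embDim (Localization.AtPrime p) = Fintype.card ι := by
  set L := Localization.AtPrime p
  have hmap : Ideal.map (algebraMap A L) p = maximalIdeal L :=
    Localization.AtPrime.map_eq_maximalIdeal
  have hx : ∀ i, x i ∈ p := fun i => hp ▸ Ideal.subset_span ⟨i, rfl⟩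
  have hxm : ∀ i, algebraMap A L (x i) ∈ maximalIdeal L := fun i =>
    hmap ▸ Ideal.mem_map_of_mem _ (hx i)
  let u : ι → maximalIdeal L := fun i => ⟨algebraMap A L (x i), hxm i⟩
  let v : ι → CotangentSpace L := fun i => (maximalIdeal L).toCotangent (u i)
  have hspan : ⊤ ≤ Submodule.span (ResidueField L) (Set.range v) := by
    have h1 : Set.range v = (maximalIdeal L).toCotangent '' (Set.range u) := by
      rw [← Set.range_comp]; rfl
    rw [h1, top_le_iff, CotangentSpace.span_image_eq_top_iff]
    apply Submodule.map_injective_of_injective (maximalIdeal L).subtype_injective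
    rw [Submodule.map_span, Submodule.map_top, Submodule.range_subtype, ← Set.range_comp]
    have h2 : maximalIdeal L = Ideal.span (Set.range (algebraMap A L ∘ x)) := by
      rw [← hmap, Set.range_comp, ← Ideal.map_span]
      exact congrArg (Ideal.map (algebraMap A L)) hp
    exact h2.symm
  have hli : LinearIndependent (ResidueField L) v := by
    rw [Fintype.linearIndependent_iff]
    intro g hg
    choose c hc using fun i => IsLocalRing.residue_surjective (g i)
    have h0 : (maximalIdeal L).toCotangent (∑ i, c i • u i) = 0 := by
      rw [map_sum, ← hg]
      refine Finset.sum_congr rfl fun i _ => ?_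
      rw [map_smul, ← hc]
      rfl
    rw [Ideal.toCotangent_eq_zero] at h0
    obtain ⟨b, hb⟩ := IsLocalization.exist_integer_multiples_of_finite p.primeCompl c
    choose d hd using hb
    have h2 : algebraMap A L (∑ i, d i * x i) ∈ Ideal.map (algebraMap A L) (p ^ 2) := by
      rw [Ideal.map_pow, hmap]
      have := Ideal.mul_mem_left _ (algebraMap A L b) h0
      convert this using 1
      simp only [map_sum, map_mul, hd, Algebra.smul_def, Submodule.coe_sum, Finset.mul_sum]
      refine Finset.sum_congr rfl fun i _ => ?_
      simp [u, mul_assoc]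
    rw [IsLocalization.algebraMap_mem_map_algebraMap_iff p.primeCompl] at h2
    obtain ⟨m, hm, h2⟩ := h2
    have h3 := h (fun i => m * d i) (by simpa [Finset.mul_sum, mul_assoc] using h2)
    intro i
    have h4 : d i ∈ p := ((Ideal.IsPrime.mem_or_mem ‹_› (h3 i)).resolve_left hm)
    rw [← hc, IsLocalRing.residue_eq_zero_iff]
    have h5 : algebraMap A L (d i) ∈ maximalIdeal L := hmap ▸ Ideal.mem_map_of_mem _ h4
    rw [hd, Algebra.smul_def] at h5
    refine (Ideal.IsPrime.mem_or_mem inferInstance h5).resolve_left ?_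
    rw [IsLocalization.AtPrime.to_map_mem_maximal_iff L p]
    exact b.2
  exact Module.finrank_eq_card_basis (Module.Basis.mk hli hspan)

lemma isPrime_span_X (S : Set (Fin 3)) :
    (Ideal.span ((X : Fin 3 → MvPolynomial (Fin 3) ℂ) '' S)).IsPrime := by
  classical
  let φ : MvPolynomial (Fin 3) ℂ →ₐ[ℂ] MvPolynomial (Fin 3) ℂ :=
    aeval (fun i => if i ∈ S then 0 else X i)
  set I := Ideal.span ((X : Fin 3 → MvPolynomial (Fin 3) ℂ) '' S)
  have h1 : (Ideal.Quotient.mkₐ ℂ I).comp φ = Ideal.Quotient.mkₐ ℂ I := by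
    apply MvPolynomial.algHom_ext
    intro i
    simp only [AlgHom.comp_apply, φ, aeval_X]
    split_ifs with h
    · rw [map_zero]; symm
      exact Ideal.Quotient.eq_zero_iff_mem.2 (Ideal.subset_span ⟨i, h, rfl⟩)
    · rfl
  have : I = RingHom.ker φ := by
    apply le_antisymm
    · rw [Ideal.span_le]
      rintro _ ⟨i, hi, rfl⟩
      simp [φ, hi]
    · intro f hf
      have h2 := DFunLike.congr_fun h1 f
      rw [AlgHom.comp_apply, (RingHom.mem_ker).1 hf, map_zero] at h2
      exact Ideal.Quotient.eq_zero_iff_mem.1 h2.symm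
  rw [this]
  exact RingHom.ker_isPrime _

lemma X_notMem (S : Set (Fin 3)) (i : Fin 3) (hi : i ∉ S) :
    (X i : MvPolynomial (Fin 3) ℂ) ∉ Ideal.span (X '' S) := by
  classical
  rw [mem_ideal_span_X_image]
  intro h
  obtain ⟨j, hj, h2⟩ := h (Finsupp.single i 1) (by simp [support_X])
  have : i ≠ j := fun h => hi (h ▸ hj)
  simp [this] at h2

lemma pderiv_mem_of_mem_sq (P : Ideal (MvPolynomial (Fin 3) ℂ)) (i : Fin 3)
    (f : MvPolynomial (Fin 3) ℂ) (hf : f ∈ P ^ 2) : pderiv i f ∈ P := by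
  rw [pow_two] at hf
  refine Submodule.mul_induction_on hf (fun a ha b hb => ?_) (fun a b ha hb => ?_)
  · rw [pderiv_mul]
    exact P.add_mem (P.mul_mem_left _ hb) (P.mul_mem_right _ ha)
  · rw [map_add]; exact P.add_mem ha hb

lemma embDim_quot (J : Ideal (MvPolynomial (Fin 3) ℂ)) (S : Finset (Fin 3))
    (hJ : J ≤ Ideal.span (X '' (S : Set (Fin 3))) ^ 2)
    (p : Ideal (MvPolynomial (Fin 3) ℂ ⧸ J)) [p.IsPrime]
    (hp : p = Ideal.map (Ideal.Quotient.mk J) (Ideal.span (X '' (S : Set (Fin 3))))) :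
    embDim (Localization.AtPrime p) = S.card := by
  classical
  set P : Ideal (MvPolynomial (Fin 3) ℂ) := Ideal.span (X '' (S : Set (Fin 3))) with hP
  have hJP : J ≤ P := hJ.trans (Ideal.pow_le_self two_ne_zero)
  have key : ∀ (I : Ideal (MvPolynomial (Fin 3) ℂ)), J ≤ I → ∀ f,
      Ideal.Quotient.mk J f ∈ Ideal.map (Ideal.Quotient.mk J) I → f ∈ I := by
    intro I hI f hf
    rw [← Ideal.mem_comap, Ideal.comap_map_of_surjective _ Ideal.Quotient.mk_surjective,
      ← RingHom.ker_eq_comap_bot, Ideal.mk_ker, sup_eq_left.2 hI] at hf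
    exact hf
  rw [embDim_of_gens p (fun i : S => Ideal.Quotient.mk J (X i.1)), Fintype.card_coe]
  · rw [hp, hP, Ideal.map_span, Set.image_image]
    congr 1
    ext f
    simp
  · intro b hb i
    choose c hc using fun i => Ideal.Quotient.mk_surjective (b i)
    have h1 : ∑ i, c i * X i.1 ∈ P ^ 2 := by
      apply key _ hJ
      rw [Ideal.map_pow, ← hp]
      simpa [hc] using hb
    have h2 := pderiv_mem_of_mem_sq P i.1 _ h1
    rw [← hc, hp]
    apply Ideal.mem_map_of_mem
    simp only [map_sum, pderiv_mul, Finset.sum_add_distrib] at h2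
    have h3 : ∑ j : S, (pderiv i.1) (c j) * X j.1 ∈ P :=
      P.sum_mem fun j _ => P.mul_mem_left _ (Ideal.subset_span ⟨j.1, j.2, rfl⟩)
    have h4 := (P.add_mem_iff_right h3).1 h2
    rw [Finset.sum_eq_single i] at h4
    · simpa using h4
    · intro j _ hj
      rw [pderiv_X_of_ne (fun h => hj (Subtype.ext h)), mul_zero]
    · simp

lemma le_two_of_add_one_le (a : WithBot ℕ∞) (h : a + 1 ≤ 2 + 1) : a ≤ 2 := by
  induction a with
  | bot => exact bot_le
  | coe a =>
    have hle : a + 1 ≤ 2 + 1 := WithBot.coe_le_coe.1 h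
    exact WithBot.coe_le_coe.2 ((ENat.add_le_add_iff_right ENat.one_ne_top).1 hle)

/-- Consider `X = X₁ ∪ X₂ ⊆ 𝔸³` over `ℂ`, where `X₁ = V(x)` and `X₂ = V((y,z)²)` is a
double line, i.e. `X = Spec ℂ[x,y,z]/((x) ∩ (y,z)²)`. Let `0` be the origin (the prime
`(x,y,z)`) and `η` the generic point of `X₂` (the prime `(y,z)`). Then
`ecodim(𝒪_{X,0}) = 1` while `ecodim(𝒪_{X,η}) = 2` (written additively as
`edim = ecodim + dim`); in particular the embedding codimension fails to be upper
semi-continuous under generization, as `η` is a generization of `0`. -/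
theorem ecodim_not_upper_semicontinuous
    (J : Ideal (MvPolynomial (Fin 3) ℂ))
    (hJ : J = Ideal.span {X 0} ⊓ (Ideal.span {X 1, X 2}) ^ 2)
    (p q : Ideal (MvPolynomial (Fin 3) ℂ ⧸ J)) [p.IsPrime] [q.IsPrime]
    (hp : p = Ideal.map (Ideal.Quotient.mk J)
      (Ideal.span {X 0, X 1, X 2} : Ideal (MvPolynomial (Fin 3) ℂ)))
    (hq : q = Ideal.map (Ideal.Quotient.mk J)
      (Ideal.span {X 1, X 2} : Ideal (MvPolynomial (Fin 3) ℂ))) :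
    q ≤ p ∧
    (embDim (Localization.AtPrime p) : WithBot ℕ∞) =
      1 + Order.krullDim (PrimeSpectrum (Localization.AtPrime p)) ∧
    (embDim (Localization.AtPrime q) : WithBot ℕ∞) =
      2 + Order.krullDim (PrimeSpectrum (Localization.AtPrime q)) := by
  have e1 : ({X 1, X 2} : Set (MvPolynomial (Fin 3) ℂ)) =
      X '' (({1, 2} : Finset (Fin 3)) : Set (Fin 3)) := by simp [Set.image_insert_eq]
  have e2 : ({X 0, X 1, X 2} : Set (MvPolynomial (Fin 3) ℂ)) =
      X '' (({0, 1, 2} : Finset (Fin 3)) : Set (Fin 3)) := by simp [Set.image_insert_eq]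
  have e12 : Ideal.span {X 1, X 2} ≤
      (Ideal.span {X 0, X 1, X 2} : Ideal (MvPolynomial (Fin 3) ℂ)) :=
    Ideal.span_mono (Set.subset_insert _ _)
  have hJ2 : J ≤ (Ideal.span {X 1, X 2}) ^ 2 := hJ ▸ inf_le_right
  have hJ3 : J ≤ (Ideal.span {X 0, X 1, X 2}) ^ 2 := hJ2.trans (Ideal.pow_right_mono e12 2)
  have hJx : J ≤ Ideal.span {X 0} := hJ ▸ inf_le_left
  have hmem : ∀ i ∈ ({1, 2} : Finset (Fin 3)), (X 0 * X i ^ 2 : MvPolynomial (Fin 3) ℂ) ∈ J := by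
    intro i hi
    rw [hJ]
    refine ⟨Ideal.mul_mem_right _ _ (Ideal.subset_span rfl), Ideal.mul_mem_left _ _ ?_⟩
    apply Ideal.pow_mem_pow
    rw [e1]
    exact Ideal.subset_span ⟨i, hi, rfl⟩
  have comap_map : ∀ (I : Ideal (MvPolynomial (Fin 3) ℂ)), J ≤ I → ∀ f,
      Ideal.Quotient.mk J f ∈ Ideal.map (Ideal.Quotient.mk J) I → f ∈ I := by
    intro I hI f hf
    rw [← Ideal.mem_comap, Ideal.comap_map_of_surjective _ Ideal.Quotient.mk_surjective,
      ← RingHom.ker_eq_comap_bot, Ideal.mk_ker, sup_eq_left.2 hI] at hf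
    exact hf
  refine ⟨hp ▸ hq ▸ Ideal.map_mono e12, ?_, ?_⟩
  · have hd : embDim (Localization.AtPrime p) = 3 := by
      rw [embDim_quot J {0, 1, 2} (e2 ▸ hJ3) p (e2 ▸ hp)]; rfl
    have hdim : ringKrullDim (Localization.AtPrime p) = 2 := by
      rw [IsLocalization.AtPrime.ringKrullDim_eq_height p (Localization.AtPrime p)]
      have hle : (p.height : WithBot ℕ∞) ≤ 2 := by
        refine (Ideal.height_le_ringKrullDim_of_isPrime).trans ?_
        have h1 := ringKrullDim_succ_le_of_surjective (Ideal.Quotient.mk J)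
          Ideal.Quotient.mk_surjective (r := X 0 * X 1 ^ 2)
          (mem_nonZeroDivisors_of_ne_zero
            (mul_ne_zero (X_ne_zero _) (pow_ne_zero _ (X_ne_zero _))))
          (Ideal.Quotient.eq_zero_iff_mem.2 (hmem 1 (by simp)))
        rw [MvPolynomial.ringKrullDim_of_isNoetherianRing, ringKrullDim_eq_zero_of_field,
          zero_add, Nat.card_fin] at h1
        have h3 : ((3 : ℕ) : WithBot ℕ∞) = 2 + 1 := by norm_num
        rw [h3] at h1
        exact le_two_of_add_one_le _ h1
      have hge : 2 ≤ p.height := by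
        have prime_of : ∀ S : Set (Fin 3), 0 ∈ S →
            (Ideal.map (Ideal.Quotient.mk J) (Ideal.span (X '' S))).IsPrime ∧
              J ≤ Ideal.span (X '' S) := by
          intro S hS
          have hJS : J ≤ Ideal.span (X '' S) := hJx.trans
            (Ideal.span_mono (by rintro _ rfl; exact ⟨0, hS, rfl⟩))
          have := isPrime_span_X S
          exact ⟨Ideal.map_isPrime_of_surjective Ideal.Quotient.mk_surjective
            (by rwa [Ideal.mk_ker]), hJS⟩
        have lt_of : ∀ S T : Set (Fin 3), 0 ∈ S → S ⊆ T → ∀ i ∈ T, i ∉ S →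
            Ideal.map (Ideal.Quotient.mk J) (Ideal.span (X '' S)) <
              Ideal.map (Ideal.Quotient.mk J) (Ideal.span (X '' T)) := by
          intro S T hS hST i hiT hiS
          refine lt_of_le_of_ne (Ideal.map_mono (Ideal.span_mono (Set.image_mono hST))) ?_
          intro h
          apply X_notMem S i hiS
          apply comap_map _ (prime_of S hS).2
          rw [h]
          exact Ideal.mem_map_of_mem _ (Ideal.subset_span ⟨i, hiT, rfl⟩)
        have := (prime_of {0} (by simp)).1
        have := (prime_of {0, 1} (by simp)).1
        have l1 := Ideal.height_add_one_le_of_lt_of_isPrime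
          (lt_of {0} {0, 1} (by simp) (by simp) 1 (by simp) (by simp))
        have l2 := lt_of {0, 1} ({0, 1, 2} : Finset (Fin 3)) (by simp)
          (by intro i; simp; tauto) 2 (by simp) (by simp)
        rw [← e2, ← hp] at l2
        have l3 := Ideal.height_add_one_le_of_lt_of_isPrime l2
        calc (2 : ℕ∞) = 0 + 1 + 1 := by norm_num
          _ ≤ _ := by
            gcongr
            exact (by simp : (0 : ℕ∞) + 1 ≤ _ + 1).trans l1
          _ ≤ _ := l3
      exact le_antisymm hle (WithBot.coe_le_coe.2 hge)
    change _ = 1 + ringKrullDim (Localization.AtPrime p)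
    rw [hd, hdim]
    norm_num
  · have hd : embDim (Localization.AtPrime q) = 2 := by
      rw [embDim_quot J {1, 2} (e1 ▸ hJ2) q (e1 ▸ hq)]; rfl
    have hdim : ringKrullDim (Localization.AtPrime q) = 0 := by
      rw [IsLocalization.AtPrime.ringKrullDim_eq_height q (Localization.AtPrime q)]
      have : q.height = 0 := by
        rw [Ideal.height_eq_zero_iff]
        refine ⟨⟨inferInstance, bot_le⟩, ?_⟩
        rintro Q ⟨hQ, -⟩ hQq
        have h0 : Ideal.Quotient.mk J (X 0) ∉ Q := by
          intro h
          have h1 := hQq h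
          rw [hq] at h1
          have h2 := comap_map _ (hJ2.trans (Ideal.pow_le_self two_ne_zero)) _ h1
          rw [e1] at h2
          exact X_notMem _ 0 (by simp) h2
        rw [hq, e1, Ideal.map_le_iff_le_comap, Ideal.span_le]
        rintro _ ⟨i, hi, rfl⟩
        have h1 := Ideal.Quotient.eq_zero_iff_mem.2 (hmem i hi)
        rw [map_mul, map_pow] at h1
        have h2 : Ideal.Quotient.mk J (X 0) * Ideal.Quotient.mk J (X i) ^ 2 ∈ Q :=
          h1 ▸ Q.zero_mem
        exact hQ.mem_of_pow_mem _ ((hQ.mem_or_mem h2).resolve_left h0)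
      rw [this]; rfl
    change _ = 2 + ringKrullDim (Localization.AtPrime q)
    rw [hd, hdim]
    norm_num
end

section
/- Let I be an ideal in a polynomial ring P = K[x_s : s ∈ S] over a field K (with S possibly infinite), and let K ⊂ L be a field extension, with P_L = L[x_s : s ∈ S] and I_L = I·P_L. Then height(I_L) = height(I). -/
open MvPolynomial in
theorem aux_exists_equiv {R σ τ : Type*} [CommRing R] (f : τ → σ) (hf : Function.Injective f) :
    ∃ e : MvPolynomial σ R ≃+* MvPolynomial ((Set.range f)ᶜ : Set σ) (MvPolynomial τ R),
      e.toRingHom.comp (rename f : MvPolynomial τ R →ₐ[R] MvPolynomial σ R).toRingHom = C := by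
  classical
  let g : σ ≃ ((Set.range f)ᶜ : Set σ) ⊕ τ :=
    ((Equiv.Set.sumCompl (Set.range f)).symm.trans (Equiv.sumComm _ _)).trans
      (Equiv.sumCongr (Equiv.refl _) (Equiv.ofInjective f hf).symm)
  have hg : ∀ t, g (f t) = Sum.inr t := by
    intro t
    have h1 : (Equiv.Set.sumCompl (Set.range f)).symm (f t) = Sum.inl ⟨f t, t, rfl⟩ :=
      Equiv.Set.sumCompl_symm_apply_of_mem (Set.mem_range_self t)
    simp only [g, Equiv.trans_apply, h1]
    simp
  refine ⟨((renameEquiv R g).trans (sumAlgEquiv R _ _)).toRingEquiv, ?_⟩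
  apply MvPolynomial.ringHom_ext
  · intro r
    simp [MvPolynomial.algebraMap_eq]
  · intro t
    simp [hg]

theorem aux_flat_rename {R σ τ : Type*} [CommRing R] (f : τ → σ) (hf : Function.Injective f) :
    (MvPolynomial.rename f : MvPolynomial τ R →ₐ[R] MvPolynomial σ R).toRingHom.Flat := by
  obtain ⟨e, he⟩ := aux_exists_equiv (R := R) f hf
  rw [← RingHom.Flat.comp_iff_of_bijective_left (g := e.toRingHom) e.bijective, he]
  exact RingHom.flat_algebraMap_iff.mpr
    (inferInstance : Module.Flat (MvPolynomial τ R) (MvPolynomial _ (MvPolynomial τ R)))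

theorem aux_prime_map_C {R ι : Type*} [CommRing R] (p : Ideal R) [p.IsPrime] :
    (p.map (MvPolynomial.C : R →+* MvPolynomial ι R)).IsPrime := by
  rw [← Ideal.Quotient.isDomain_iff_prime]
  exact (MvPolynomial.quotientEquivQuotientMvPolynomial (σ := ι) p).symm.toMulEquiv.isDomain _

theorem aux_prime_rename {R σ τ : Type*} [CommRing R] (f : τ → σ) (hf : Function.Injective f)
    (p : Ideal (MvPolynomial τ R)) [p.IsPrime] :
    (p.map (MvPolynomial.rename f : MvPolynomial τ R →ₐ[R] MvPolynomial σ R).toRingHom).IsPrime := by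
  obtain ⟨e, he⟩ := aux_exists_equiv (R := R) f hf
  have h := aux_prime_map_C (ι := ((Set.range f)ᶜ : Set σ)) p
  rw [← he, ← Ideal.map_map] at h
  have h2 := Ideal.comap_isPrime e.toRingHom _ (H := h)
  have h3 := Ideal.comap_map_of_bijective e.toRingHom e.bijective (I := p.map
    (MvPolynomial.rename f : MvPolynomial τ R →ₐ[R] MvPolynomial σ R).toRingHom)
  rwa [h3] at h2

theorem aux_comap_map_rename {R σ τ : Type*} [CommRing R] (f : τ → σ)
    (hf : Function.Injective f) (p : Ideal (MvPolynomial τ R)) :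
    (p.map (MvPolynomial.rename f : MvPolynomial τ R →ₐ[R] MvPolynomial σ R).toRingHom).comap
      (MvPolynomial.rename f : MvPolynomial τ R →ₐ[R] MvPolynomial σ R).toRingHom = p := by
  refine le_antisymm ?_ Ideal.le_comap_map
  intro x hx
  have h := Ideal.mem_map_of_mem (MvPolynomial.killCompl (R := R) hf).toRingHom
    (Ideal.mem_comap.mp hx)
  rw [Ideal.map_map] at h
  have h2 : (MvPolynomial.killCompl (R := R) hf).toRingHom.comp
    (MvPolynomial.rename f : MvPolynomial τ R →ₐ[R] MvPolynomial σ R).toRingHom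
      = RingHom.id _ := by
    refine RingHom.ext fun y => ?_
    exact MvPolynomial.killCompl_rename_app hf y
  rw [h2, Ideal.map_id] at h
  have h3 : (MvPolynomial.killCompl (R := R) hf) (MvPolynomial.rename f x) ∈ p := h
  rwa [MvPolynomial.killCompl_rename_app] at h3

theorem aux_height_comap_le {A B : Type*} [CommRing A] [CommRing B] (φ : A →+* B)
    (hφ : φ.Flat) (Q : Ideal B) [Q.IsPrime] : (Q.comap φ).height ≤ Q.height := by
  algebraize [φ]
  rw [(⟨Q.comap φ, inferInstance⟩ : PrimeSpectrum A).height_eq_orderHeight,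
    (⟨Q, inferInstance⟩ : PrimeSpectrum B).height_eq_orderHeight]
  refine Order.height_le fun l hl => ?_
  have : Q.LiesOver l.last.asIdeal := ⟨by rw [hl]; rfl⟩
  obtain ⟨l', h1, h2, -⟩ := Ideal.exists_ltSeries_of_hasGoingDown l Q
  rw [← h1]
  exact Order.length_le_height h2.le

/-- The inclusion of the polynomial ring in finitely many of the variables. -/
noncomputable def auxIncl (R : Type*) {S : Type*} [CommRing R] (T : Finset S) :
    MvPolynomial T R →+* MvPolynomial S R :=
  (MvPolynomial.rename (Subtype.val : T → S) : MvPolynomial T R →ₐ[R] MvPolynomial S R).toRingHom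

theorem aux_witness {R S : Type*} [CommRing R] (m : ℕ) :
    ∀ (Q : Ideal (MvPolynomial S R)) [Q.IsPrime], (m : ℕ∞) ≤ Q.height →
      ∃ T₀ : Finset S, ∀ T, T₀ ⊆ T → (m : ℕ∞) ≤ (Q.comap (auxIncl R T)).height := by
  classical
  induction m with
  | zero => intro Q _ _; exact ⟨∅, fun T _ => by simp⟩
  | succ m ih =>
    intro Q _ hQ
    have h1 : ¬ Q.height ≤ (m : ℕ∞) := by
      intro h
      have := hQ.trans h
      norm_cast at this
      omega
    rw [Ideal.height_le_iff] at h1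
    push Not at h1
    obtain ⟨Q', hQ', hlt, hm⟩ := h1
    obtain ⟨T₁, hT₁⟩ := ih Q' hm
    obtain ⟨x, hx, hx'⟩ := SetLike.exists_of_lt hlt
    refine ⟨T₁ ∪ x.vars, fun T hT => ?_⟩
    have h2 := hT₁ T (Finset.union_subset_left hT)
    obtain ⟨y, hy⟩ := MvPolynomial.exists_rename_eq_of_vars_subset_range x
      (Subtype.val : T → S) Subtype.val_injective
      (by intro a ha; simpa using Finset.union_subset_right hT ha)
    have hlt' : Q'.comap (auxIncl R T) < Q.comap (auxIncl R T) := by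
      refine SetLike.lt_iff_le_and_exists.mpr ⟨Ideal.comap_mono hlt.le, y, ?_, ?_⟩
      · change MvPolynomial.rename _ y ∈ Q
        rwa [hy]
      · change ¬ MvPolynomial.rename _ y ∈ Q'
        rwa [hy]
    have h3 := Ideal.height_add_one_le_of_lt_of_isPrime hlt'
    refine le_trans ?_ h3
    push_cast
    gcongr

theorem aux_extended {R S : Type*} [CommRing R] (p : Ideal (MvPolynomial S R)) [p.IsPrime]
    (n : ℕ) (hn : p.height = n) :
    ∃ T₀ : Finset S, ∀ T, T₀ ⊆ T → (p.comap (auxIncl R T)).map (auxIncl R T) = p := by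
  obtain ⟨T₀, hT₀⟩ := aux_witness n p hn.ge
  refine ⟨T₀, fun T hT => ?_⟩
  have h1 := hT₀ T hT
  have hle : (p.comap (auxIncl R T)).map (auxIncl R T) ≤ p := Ideal.map_comap_le
  have : ((p.comap (auxIncl R T)).map (auxIncl R T)).IsPrime :=
    aux_prime_rename _ Subtype.val_injective _
  have h2 := aux_height_comap_le (auxIncl R T) (aux_flat_rename _ Subtype.val_injective)
    ((p.comap (auxIncl R T)).map (auxIncl R T))
  rw [show ((p.comap (auxIncl R T)).map (auxIncl R T)).comap (auxIncl R T) =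
    p.comap (auxIncl R T) from aux_comap_map_rename _ Subtype.val_injective _] at h2
  have : ((p.comap (auxIncl R T)).map (auxIncl R T)).FiniteHeight :=
    ⟨Or.inr (ne_top_of_le_ne_top (by simp [hn]) (Ideal.height_mono hle))⟩
  exact Ideal.eq_of_le_of_height_le _ hle (hn.le.trans (h1.trans h2))

theorem aux_height_minimal {A B : Type*} [CommRing A] [CommRing B] [IsNoetherianRing A]
    [IsNoetherianRing B] (φ : A →+* B) (p : Ideal A) [p.IsPrime] (Q : Ideal B) [Q.IsPrime]
    (hQ : Q.comap φ = p) (hmin : Q ∈ (p.map φ).minimalPrimes) : Q.height ≤ p.height := by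
  algebraize [φ]
  have : Q.LiesOver p := ⟨hQ.symm⟩
  have h := Ideal.height_le_height_add_of_liesOver p Q
  have hle : p.map (algebraMap A B) ≤ Q := hmin.1.2
  have hsurj := Ideal.Quotient.mk_surjective (I := p.map (algebraMap A B))
  have hc : (Q.map (Ideal.Quotient.mk (p.map (algebraMap A B)))).comap
      (Ideal.Quotient.mk (p.map (algebraMap A B))) = Q := by
    rw [Ideal.comap_map_of_surjective _ hsurj, ← RingHom.ker_eq_comap_bot, Ideal.mk_ker]
    exact sup_eq_left.mpr hle
  have hp : (Q.map (Ideal.Quotient.mk (p.map (algebraMap A B)))).IsPrime :=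
    Ideal.map_isPrime_of_surjective hsurj (by rwa [Ideal.mk_ker])
  have h0 : (Q.map (Ideal.Quotient.mk (p.map (algebraMap A B)))).height = 0 := by
    rw [Ideal.height_eq_zero_iff]
    refine ⟨⟨hp, bot_le⟩, fun J hJ hJQ => ?_⟩
    have := hJ.1
    have h1 : J.comap (Ideal.Quotient.mk (p.map (algebraMap A B))) ≤ Q := by
      rw [← hc]; exact Ideal.comap_mono hJQ
    have h2 : p.map (algebraMap A B) ≤ J.comap (Ideal.Quotient.mk (p.map (algebraMap A B))) := by
      conv_lhs => rw [← Ideal.mk_ker (I := p.map (algebraMap A B))]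
      exact Ideal.comap_mono bot_le
    exact Ideal.map_le_iff_le_comap.mpr (hmin.2 ⟨inferInstance, h2⟩ h1)
  rwa [h0, add_zero] at h

theorem aux_faithfullyFlat {K L S : Type*} [Field K] [Field L] [Algebra K L] :
    (MvPolynomial.map (σ := S) (algebraMap K L)).FaithfullyFlat := by
  let := MvPolynomial.algebraMvPolynomial (R := K) (S := L) (σ := S)
  have : Module.FaithfullyFlat (MvPolynomial S K) (MvPolynomial S L) :=
    .of_linearEquiv _ _
      (Algebra.IsPushout.equiv K (MvPolynomial S K) L (MvPolynomial S L)).symm.toLinearEquiv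
  exact (RingHom.faithfullyFlat_algebraMap_iff (R := MvPolynomial S K)
    (S := MvPolynomial S L)).mpr this

theorem aux_key {K L S : Type*} [Field K] [Field L] [Algebra K L]
    (p : Ideal (MvPolynomial S K)) [p.IsPrime] (n : ℕ) (hn : p.height = n) :
    ∃ Q : Ideal (MvPolynomial S L), Q.IsPrime ∧
      p.map (MvPolynomial.map (algebraMap K L)) ≤ Q ∧ Q.height ≤ n := by
  classical
  set φ : MvPolynomial S K →+* MvPolynomial S L := MvPolynomial.map (algebraMap K L) with hφ
  have hff : φ.FaithfullyFlat := aux_faithfullyFlat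
  obtain ⟨-, hs⟩ := RingHom.FaithfullyFlat.iff_flat_and_comap_surjective.mp hff
  obtain ⟨Q₁, hQ₁⟩ := hs ⟨p, inferInstance⟩
  have hQ₁' : Q₁.asIdeal.comap φ = p := congrArg PrimeSpectrum.asIdeal hQ₁
  obtain ⟨Q, hQ, hQQ₁⟩ := Ideal.exists_minimalPrimes_le
    (Ideal.map_le_iff_le_comap.mpr hQ₁'.ge : p.map φ ≤ Q₁.asIdeal)
  have hQp : Q.IsPrime := hQ.1.1
  have hover : Q.comap φ = p :=
    le_antisymm ((Ideal.comap_mono hQQ₁).trans hQ₁'.le) (Ideal.map_le_iff_le_comap.mp hQ.1.2)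
  refine ⟨Q, hQp, hQ.1.2, ?_⟩
  by_contra hcon
  have hm : ((n + 1 : ℕ) : ℕ∞) ≤ Q.height := by
    push_cast
    exact Order.add_one_le_of_lt (not_le.mp hcon)
  obtain ⟨T₁, hT₁⟩ := aux_witness (n + 1) Q hm
  obtain ⟨T₂, hT₂⟩ := aux_extended p n hn
  let T := T₁ ∪ T₂
  have h1 := hT₁ T Finset.subset_union_left
  have h2 := hT₂ T Finset.subset_union_right
  let ψ : MvPolynomial T K →+* MvPolynomial T L := MvPolynomial.map (algebraMap K L)
  have hcomm : φ.comp (auxIncl K T) = (auxIncl L T).comp ψ := by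
    refine RingHom.ext fun x => ?_
    exact MvPolynomial.map_rename _ _ _
  have hov : (Q.comap (auxIncl L T)).comap ψ = p.comap (auxIncl K T) := by
    rw [Ideal.comap_comap, ← hcomm, ← Ideal.comap_comap, hover]
  have hmin : Q.comap (auxIncl L T) ∈ ((p.comap (auxIncl K T)).map ψ).minimalPrimes := by
    refine ⟨⟨inferInstance, Ideal.map_le_iff_le_comap.mpr hov.ge⟩, fun J hJ hJQ => ?_⟩
    have := hJ.1
    have hJp : (J.map (auxIncl L T)).IsPrime := aux_prime_rename _ Subtype.val_injective _
    have h3 : p.map φ ≤ J.map (auxIncl L T) := by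
      rw [← h2, Ideal.map_map, hcomm, ← Ideal.map_map]
      exact Ideal.map_mono hJ.2
    have h4 := hQ.2 ⟨hJp, h3⟩ (Ideal.map_le_iff_le_comap.mpr hJQ)
    refine (Ideal.comap_mono h4).trans ?_
    exact (aux_comap_map_rename _ Subtype.val_injective J).le
  have h5 := aux_height_minimal ψ (p.comap (auxIncl K T)) _ hov hmin
  have h6 := aux_height_comap_le (auxIncl K T) (aux_flat_rename _ Subtype.val_injective) p
  have h7 := h1.trans (h5.trans (h6.trans hn.le))
  norm_cast at h7
  omega


/-- Let `I` be an ideal of a polynomial ring `P = K[xₛ : s ∈ S]` over a field `K` (with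
`S` possibly infinite), let `K ⊆ L` be a field extension, and let `I_L = I·P_L` be the
extension of `I` to `P_L = L[xₛ : s ∈ S]`. Then `height(I_L) = height(I)`. -/
theorem idealHeight_map_polynomial_base_change {K L : Type*} [Field K] [Field L]
    [Algebra K L] {S : Type*} (I : Ideal (MvPolynomial S K)) :
    idealHeight (I.map (MvPolynomial.map (algebraMap K L))) = idealHeight I := by
  apply le_antisymm
  · refine le_iInf₂ fun p hp => ?_
    by_cases htop : Order.height p = ⊤
    · rw [htop]; exact le_top
    obtain ⟨n, hn⟩ := ENat.ne_top_iff_exists.mp htop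
    obtain ⟨Q, hQ, hle, hh⟩ := aux_key (L := L) p.asIdeal n
      (p.height_eq_orderHeight.trans hn.symm)
    rw [← hn]
    refine le_trans (iInf₂_le (⟨Q, hQ⟩ : PrimeSpectrum _) ((Ideal.map_mono hp).trans hle)) ?_
    rw [← PrimeSpectrum.height_eq_orderHeight]
    exact hh
  · refine le_iInf₂ fun Q hQ => ?_
    refine le_trans (iInf₂_le (PrimeSpectrum.comap (MvPolynomial.map (algebraMap K L)) Q)
      (Ideal.map_le_iff_le_comap.mp hQ)) ?_
    rw [← PrimeSpectrum.height_eq_orderHeight, ← PrimeSpectrum.height_eq_orderHeight]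
    exact aux_height_comap_le _ aux_faithfullyFlat.flat Q.asIdeal
end
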